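/- arXiv:1706.07111 — 3 statements merged into one kernel-verified Lean document; each statement's English description precedes it below -/
import Mathlib

section
/- Let b ∈ L¹(ℝ^d) satisfy ∫ b = 0 and supp b ⊆ B(x₀, r/2) for some x₀ ∈ ℝ^d and r > 0. Then the upper integral ∫_{t>r} ∫_{ℝ^d} ( sup_{φ∈𝒞} | t^{−d} ∫ b(z) φ(t^{−1}(x−z)) dz | ) dx (dt/t) is at most C(d) · ‖ω‖_Dini · ‖b‖_{L¹(ℝ^d)}, where C(d) depends only on the dimension d. -/
open MeasureTheory
open scoped ENNReal NNReal

noncomputable section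

/-- Testing a mean-zero function `b` supported in `B(x₀, r/2)` against the bump `φ` at scale
`t > r` gains a factor `ω (r / (2t))`, and vanishes unless `‖x - x₀‖ ≤ 2t`. -/
lemma norm_integral_mul_bump_le {d : ℕ} {ω : ℝ → ℝ} (hmono : MonotoneOn ω (Set.Ici (0 : ℝ)))
    {b : EuclideanSpace ℝ (Fin d) → ℂ} (hb : Integrable b)
    {x₀ : EuclideanSpace ℝ (Fin d)} {r : ℝ} (hr : 0 < r)
    (hsupp : Function.support b ⊆ Metric.closedBall x₀ (r / 2)) (hmean : (∫ z, b z) = 0)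
    {φ : EuclideanSpace ℝ (Fin d) → ℂ} (hφs : Function.support φ ⊆ Metric.closedBall 0 1)
    (hφ : ∀ z z', ‖φ z - φ z'‖ ≤ ω ‖z - z'‖) (hω : ∀ t ∈ Set.Ici (0 : ℝ), 0 ≤ ω t)
    {t : ℝ} (ht : r < t) (x : EuclideanSpace ℝ (Fin d)) :
    ‖∫ z, b z * φ (t⁻¹ • (x - z))‖ ≤
      (Metric.closedBall x₀ (2 * t)).indicator
        (fun _ => ω (r / (2 * t)) * ∫ z, ‖b z‖) x := by
  have ht0 : 0 < t := hr.trans ht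
  have hq : 0 ≤ r / (2 * t) := by positivity
  by_cases hx : x ∈ Metric.closedBall x₀ (2 * t)
  · rw [Set.indicator_of_mem hx]
    by_cases hi : Integrable fun z => b z * φ (t⁻¹ • (x - z))
    · have hsub : (∫ z, b z * φ (t⁻¹ • (x - z))) =
          ∫ z, b z * (φ (t⁻¹ • (x - z)) - φ (t⁻¹ • (x - x₀))) := by
        simp_rw [mul_sub]
        rw [integral_sub hi (hb.mul_const _), integral_mul_const, hmean, zero_mul, sub_zero]
      rw [hsub, ← integral_const_mul]
      refine norm_integral_le_of_norm_le (hb.norm.const_mul _) (.of_forall fun z => ?_)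
      rw [norm_mul, mul_comm]
      by_cases hz : b z = 0
      · simp [hz]
      refine mul_le_mul_of_nonneg_right ((hφ _ _).trans ?_) (norm_nonneg _)
      refine hmono (norm_nonneg _) hq ?_
      have hz' : ‖z - x₀‖ ≤ r / 2 := by simpa [dist_eq_norm] using hsupp hz
      rw [← smul_sub, norm_smul, sub_sub_sub_cancel_left, norm_sub_rev, norm_inv,
        Real.norm_of_nonneg ht0.le, inv_mul_eq_div, ← div_div]
      gcongr
    · rw [integral_undef hi, norm_zero]
      exact mul_nonneg (hω _ hq) (integral_nonneg fun _ => norm_nonneg _)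
  · rw [Set.indicator_of_notMem hx]
    have h0 : ∀ z, b z * φ (t⁻¹ • (x - z)) = 0 := by
      intro z
      by_contra h
      obtain ⟨h1, h2⟩ := mul_ne_zero_iff.mp h
      have hz : ‖z - x₀‖ ≤ r / 2 := by simpa [dist_eq_norm] using hsupp h1
      have hw : ‖t⁻¹ • (x - z)‖ ≤ 1 := by simpa using hφs h2
      rw [norm_smul, norm_inv, Real.norm_of_nonneg ht0.le, inv_mul_le_iff₀ ht0] at hw
      refine hx ?_
      rw [Metric.mem_closedBall, dist_eq_norm]
      have := norm_sub_le_norm_sub_add_norm_sub x z x₀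
      linarith
    simp [h0]

/-- The change of variables `s = r / (2t)` in the Dini integral. -/
lemma lintegral_modulus_comp_div_le {ω : ℝ → ℝ} {r : ℝ} (hr : 0 < r) :
    ∫⁻ t in Set.Ioi r, ENNReal.ofReal (ω (r / (2 * t)) * t⁻¹) ≤
      ∫⁻ s in Set.Ioc (0 : ℝ) 1, ENNReal.ofReal (ω s / s) := by
  have hderiv : ∀ t ∈ Set.Ioi r,
      HasDerivWithinAt (fun t => r / (2 * t)) (-(r / (2 * t ^ 2))) (Set.Ioi r) t := by
    intro t ht
    have ht0 : t ≠ 0 := (hr.trans ht).ne'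
    have h := ((hasDerivAt_inv ht0).const_mul (r / 2)).hasDerivWithinAt (s := Set.Ioi r)
    refine (h.congr_deriv ?_).congr_of_mem (fun y _ => ?_) ht <;> field_simp
  have hinj : Set.InjOn (fun t => r / (2 * t)) (Set.Ioi r) := by
    intro s hs t ht h
    have hs0 : s ≠ 0 := (hr.trans hs).ne'
    have ht0 : t ≠ 0 := (hr.trans ht).ne'
    field_simp at h
    exact h.symm
  have himg : (fun t => r / (2 * t)) '' Set.Ioi r ⊆ Set.Ioc (0 : ℝ) 1 := by
    rintro _ ⟨t, ht, rfl⟩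
    have hrt : r < t := ht
    have ht0 : 0 < t := hr.trans ht
    refine ⟨by positivity, ?_⟩
    dsimp only
    rw [div_le_one (by positivity)]
    linarith
  refine le_trans (le_of_eq ?_) (lintegral_mono_set himg)
  rw [lintegral_image_eq_lintegral_abs_deriv_mul measurableSet_Ioi hderiv hinj]
  refine setLIntegral_congr_fun measurableSet_Ioi fun t ht => ?_
  have ht0 : 0 < t := hr.trans ht
  rw [← ENNReal.ofReal_mul (abs_nonneg _), abs_neg, abs_of_pos (by positivity)]
  congr 1
  field_simp

/-- **`L¹` bound on the embedding of a Calderón–Zygmund atom above its scale.**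
If `b` is integrable, has mean zero and is supported in `B(x₀, r/2)`, then the upper integral
`∫_{t>r} ∫ sup_{φ∈𝒞} |t^{-d} ∫ b(z) φ(t⁻¹(x-z)) dz| dx dt/t ≤ C(d) ‖ω‖_Dini ‖b‖₁`. -/
theorem atom_embedding_L1 (d : ℕ) :
    ∃ C : ℝ, 0 < C ∧
      ∀ (ω : ℝ → ℝ),
        (∀ t ∈ Set.Ici (0 : ℝ), 0 ≤ ω t) →
        MonotoneOn ω (Set.Ici (0 : ℝ)) →
        (∀ u s t : ℝ, 0 ≤ u → 0 ≤ s → 0 ≤ t → u ≤ s + t → ω u ≤ ω s + ω t) →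
        IntegrableOn (fun t => ω t / t) (Set.Ioc (0 : ℝ) 1) →
      ∀ (b : EuclideanSpace ℝ (Fin d) → ℂ), Integrable b →
      ∀ (x₀ : EuclideanSpace ℝ (Fin d)) (r : ℝ), 0 < r →
        Function.support b ⊆ Metric.closedBall x₀ (r / 2) →
        (∫ z, b z) = 0 →
        (∫⁻ t in Set.Ioi r,
            (∫⁻ x : EuclideanSpace ℝ (Fin d),
              ⨆ (φ : EuclideanSpace ℝ (Fin d) → ℂ)
                (_ : (∫ z, φ z = 0) ∧ Function.support φ ⊆ Metric.closedBall 0 1 ∧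
                      ∀ z z', ‖φ z - φ z'‖ ≤ ω ‖z - z'‖),
                (‖((t : ℂ) ^ d)⁻¹ * ∫ z, b z * φ (t⁻¹ • (x - z))‖₊ : ℝ≥0∞)
              ∂volume) * ENNReal.ofReal t⁻¹ ∂volume)
          ≤ ENNReal.ofReal (C * (∫ t in Set.Ioc (0 : ℝ) 1, ω t / t) * ∫ z, ‖b z‖) := by
  set V : ℝ := (volume (Metric.ball (0 : EuclideanSpace ℝ (Fin d)) 1)).toReal with hV
  have hVpos : 0 < V :=
    ENNReal.toReal_pos (Metric.measure_ball_pos _ _ one_pos).ne' measure_ball_lt_top.ne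
  refine ⟨2 ^ d * V, by positivity, ?_⟩
  intro ω hω hmono _ hint b hb x₀ r hr hsupp hmean
  have hB : 0 ≤ ∫ z, ‖b z‖ := integral_nonneg fun _ => norm_nonneg _
  set B : ℝ := ∫ z, ‖b z‖
  have hscale : ∀ t ∈ Set.Ioi r,
      (∫⁻ x : EuclideanSpace ℝ (Fin d),
        ⨆ (φ : EuclideanSpace ℝ (Fin d) → ℂ)
          (_ : (∫ z, φ z = 0) ∧ Function.support φ ⊆ Metric.closedBall 0 1 ∧
                ∀ z z', ‖φ z - φ z'‖ ≤ ω ‖z - z'‖),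
          (‖((t : ℂ) ^ d)⁻¹ * ∫ z, b z * φ (t⁻¹ • (x - z))‖₊ : ℝ≥0∞)) * ENNReal.ofReal t⁻¹
        ≤ ENNReal.ofReal (2 ^ d * V * B) * ENNReal.ofReal (ω (r / (2 * t)) * t⁻¹) := by
    intro t ht
    have ht0 : 0 < t := hr.trans ht
    have hωt : 0 ≤ ω (r / (2 * t)) := hω _ (Set.mem_Ici.mpr (by positivity))
    have hpt : ∀ x : EuclideanSpace ℝ (Fin d),
        (⨆ (φ : EuclideanSpace ℝ (Fin d) → ℂ)
          (_ : (∫ z, φ z = 0) ∧ Function.support φ ⊆ Metric.closedBall 0 1 ∧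
                ∀ z z', ‖φ z - φ z'‖ ≤ ω ‖z - z'‖),
          (‖((t : ℂ) ^ d)⁻¹ * ∫ z, b z * φ (t⁻¹ • (x - z))‖₊ : ℝ≥0∞)) ≤
        (Metric.closedBall x₀ (2 * t)).indicator
          (fun _ => ENNReal.ofReal ((t ^ d)⁻¹ * (ω (r / (2 * t)) * B))) x := by
      refine fun x => iSup₂_le fun φ ⟨_, hφs, hφ⟩ => ?_
      have h := norm_integral_mul_bump_le hmono hb hr hsupp hmean hφs hφ hω ht x
      rw [← enorm_eq_nnnorm, ← ofReal_norm, norm_mul, norm_inv, norm_pow,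
        Complex.norm_real, Real.norm_of_nonneg ht0.le]
      by_cases hx : x ∈ Metric.closedBall x₀ (2 * t)
      · rw [Set.indicator_of_mem hx] at h ⊢
        gcongr
      · rw [Set.indicator_of_notMem hx] at h ⊢
        simp [norm_le_zero_iff.mp h]
    calc _ ≤ (∫⁻ x, (Metric.closedBall x₀ (2 * t)).indicator
          (fun _ => ENNReal.ofReal ((t ^ d)⁻¹ * (ω (r / (2 * t)) * B))) x) *
            ENNReal.ofReal t⁻¹ := by
          gcongr with x
          exact hpt x
      _ = ENNReal.ofReal (2 ^ d * V * B) * ENNReal.ofReal (ω (r / (2 * t)) * t⁻¹) := by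
          rw [lintegral_indicator_const Metric.isClosed_closedBall.measurableSet,
            Measure.addHaar_closedBall _ _ (by positivity), finrank_euclideanSpace_fin,
            ← ENNReal.ofReal_toReal (a := volume (Metric.ball _ _)) measure_ball_lt_top.ne, ← hV,
            ← ENNReal.ofReal_mul (by positivity), ← ENNReal.ofReal_mul (by positivity),
            ← ENNReal.ofReal_mul (by positivity), ← ENNReal.ofReal_mul (by positivity)]
          congr 1
          rw [mul_pow]
          field_simp
  calc _ ≤ ∫⁻ t in Set.Ioi r,
        ENNReal.ofReal (2 ^ d * V * B) * ENNReal.ofReal (ω (r / (2 * t)) * t⁻¹) :=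
        setLIntegral_mono' measurableSet_Ioi hscale
    _ = ENNReal.ofReal (2 ^ d * V * B) *
          ∫⁻ t in Set.Ioi r, ENNReal.ofReal (ω (r / (2 * t)) * t⁻¹) :=
        lintegral_const_mul' _ _ ENNReal.ofReal_ne_top
    _ ≤ ENNReal.ofReal (2 ^ d * V * B) * ∫⁻ s in Set.Ioc (0 : ℝ) 1, ENNReal.ofReal (ω s / s) :=
        mul_le_mul' le_rfl (lintegral_modulus_comp_div_le hr)
    _ = ENNReal.ofReal (2 ^ d * V * (∫ t in Set.Ioc (0 : ℝ) 1, ω t / t) * B) := by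
        rw [← ofReal_integral_eq_lintegral_ofReal hint
          (ae_restrict_of_forall_mem measurableSet_Ioc fun s hs =>
            div_nonneg (hω s hs.1.le) hs.1.le), ← ENNReal.ofReal_mul (by positivity)]
        congr 1
        ring
end
end

section
/- Let 1 < p, q < ∞, let 0 ≤ c < 1, and let (Ω,μ), (Ω',ν) be σ-finite measure spaces. Let (T_k)_{k∈ℕ} be a sequence of operators mapping measurable functions on Ω to measurable functions on Ω', each subadditive (|T_k(f+g)| ≤ |T_k f| + |T_k g| a.e.) and each bounded from L^{p,1}(Ω) to L^{p,∞}(Ω'). Suppose there is K < ∞ such that for every pair of measurable sets H ⊆ Ω, G ⊆ Ω' with 0 < μ(H) < ∞ and 0 < ν(G) < ∞ there exist measurable subsets H' ⊆ H and G' ⊆ G with (ν(G∖G')/ν(G))^{1−1/p} + (μ(H∖H')/μ(H))^{1/p} ≤ c, such that for every k and every measurable f supported on H': (∫_{G'} |T_k f|^q dν)^{1/q} ≤ K (ν(G)/μ(H))^{1/q−1/p} (∫_Ω |f|^q dμ)^{1/q}. Then there is a constant C depending only on p, q, c and K such that for every sequence (f_k) of functions in L^{p,1}(Ω): ‖ (Σ_k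 |T_k f_k|^q)^{1/q} ‖_{L^{p,∞}(Ω')} ≤ C ‖ (Σ_k |f_k|^q)^{1/q} ‖_{L^{p,1}(Ω)}. -/
open MeasureTheory
open scoped ENNReal NNReal

noncomputable section

/-- The weak `L^{p,∞}` quasinorm `sup_{λ>0} λ μ({g > λ})^{1/p}` of an
`ℝ≥0∞`-valued function. -/
def weakNorm {α : Type*} [MeasurableSpace α] (μ : Measure α) (p : ℝ)
    (g : α → ℝ≥0∞) : ℝ≥0∞ :=
  ⨆ (l : ℝ) (_ : 0 < l), ENNReal.ofReal l * μ {x | ENNReal.ofReal l < g x} ^ (1 / p)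

/-- The Lorentz `L^{p,1}` norm `p ∫_0^∞ μ({g > λ})^{1/p} dλ` of an
`ℝ≥0∞`-valued function. -/
def lorentzNorm {α : Type*} [MeasurableSpace α] (μ : Measure α) (p : ℝ)
    (g : α → ℝ≥0∞) : ℝ≥0∞ :=
  ENNReal.ofReal p * ∫⁻ l in Set.Ioi (0 : ℝ), μ {x | ENNReal.ofReal l < g x} ^ (1 / p)

/-- The `ℓ^q` norm of the first `N` members of a sequence of complex-valued functions. -/
def partialLq {α : Type*} (q : ℝ) (N : ℕ) (h : ℕ → α → ℂ) (x : α) : ℝ≥0∞ :=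
  (∑ k ∈ Finset.range N, ‖h k x‖ₑ ^ q) ^ (1 / q)

section SequenceNorm

variable {α : Type*} {q : ℝ} {N : ℕ}

lemma measurable_partialLq [MeasurableSpace α] {h : ℕ → α → ℂ} (hh : ∀ k, Measurable (h k)) :
    Measurable (partialLq q N h) := by
  unfold partialLq
  exact (Finset.measurable_sum _ fun k _ => (hh k).enorm.pow_const q).pow_const _

lemma partialLq_mono (hq : 1 < q) {h h' : ℕ → α → ℂ} {x y : α}
    (hle : ∀ k, ‖h k x‖ₑ ≤ ‖h' k y‖ₑ) : partialLq q N h x ≤ partialLq q N h' y := by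
  unfold partialLq
  gcongr
  exact hle _

lemma partialLq_rpow (hq : 1 < q) (h : ℕ → α → ℂ) (x : α) :
    partialLq q N h x ^ q = ∑ k ∈ Finset.range N, ‖h k x‖ₑ ^ q := by
  unfold partialLq
  rw [← ENNReal.rpow_mul, one_div_mul_cancel (by positivity), ENNReal.rpow_one]

lemma enorm_le_partialLq (hq : 1 < q) (h : ℕ → α → ℂ) (x : α) {k : ℕ} (hk : k < N) :
    ‖h k x‖ₑ ≤ partialLq q N h x := by
  have h0 : (0 : ℝ) < q := by linarith
  rw [← ENNReal.rpow_le_rpow_iff h0, partialLq_rpow hq]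
  exact Finset.single_le_sum (f := fun k => ‖h k x‖ₑ ^ q) (fun _ _ => zero_le)
    (Finset.mem_range.2 hk)

lemma partialLq_le_sum (hq : 1 < q) (h : ℕ → α → ℂ) (x : α) :
    partialLq q N h x ≤ ∑ k ∈ Finset.range N, ‖h k x‖ₑ := by
  induction N with
  | zero => simp [partialLq, show (0 : ℝ) < q by linarith]
  | succ N ih =>
    rw [Finset.sum_range_succ]
    refine le_trans ?_ (add_le_add_left ih _)
    refine le_trans (le_of_eq ?_) (ENNReal.rpow_add_rpow_le_add _ _ hq.le)
    rw [partialLq_rpow hq, ← Finset.sum_range_succ (fun k => ‖h k x‖ₑ ^ q)]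
    rfl

lemma partialLq_le_add (hq : 1 < q) {h u v : ℕ → α → ℂ} {x : α}
    (hle : ∀ k, ‖h k x‖ ≤ ‖u k x‖ + ‖v k x‖) :
    partialLq q N h x ≤ partialLq q N u x + partialLq q N v x := by
  refine le_trans ?_ (ENNReal.Lp_add_le _ _ _ hq.le)
  unfold partialLq
  gcongr with k
  rw [← ofReal_norm, ← ofReal_norm, ← ofReal_norm,
    ← ENNReal.ofReal_add (norm_nonneg _) (norm_nonneg _)]
  exact ENNReal.ofReal_le_ofReal (hle k)

lemma partialLq_le_tsum (hq : 1 < q) (h : ℕ → α → ℂ) (x : α) :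
    partialLq q N h x ≤ (∑' k, ‖h k x‖ₑ ^ q) ^ (1 / q) := by
  unfold partialLq
  gcongr
  exact ENNReal.sum_le_tsum _

lemma monotone_partialLq (hq : 1 < q) (h : ℕ → α → ℂ) (x : α) :
    Monotone fun N => partialLq q N h x := by
  intro M N hMN
  unfold partialLq
  dsimp only
  gcongr

lemma tendsto_partialLq (h : ℕ → α → ℂ) (x : α) :
    Filter.Tendsto (fun N => partialLq q N h x) Filter.atTop
      (nhds ((∑' k, ‖h k x‖ₑ ^ q) ^ (1 / q))) :=
  (ENNReal.continuous_rpow_const.tendsto _).comp (ENNReal.tendsto_nat_tsum _)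

lemma partialLq_eq_zero_of_notMem (hq : 1 < q) {f : ℕ → α → ℂ} {H : Set α}
    (hsupp : ∀ k, Function.support (f k) ⊆ H) {x : α} (hx : x ∉ H) : partialLq q N f x = 0 := by
  have h0 : ∀ k, f k x = 0 := fun k => Function.notMem_support.1 fun h => hx (hsupp k h)
  have hq0 : 0 < q := by linarith
  simp [partialLq, h0, hq0]

end SequenceNorm

section LorentzNorms

variable {α : Type*} [MeasurableSpace α] {μ : Measure α} {p : ℝ}

lemma measurable_distribution_rpow (hp : 1 < p) (g : α → ℝ≥0∞) :
    Measurable fun l : ℝ => μ {x | ENNReal.ofReal l < g x} ^ (1 / p) := by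
  refine Antitone.measurable fun a b hab => ?_
  gcongr with x

lemma lorentzNorm_mono (hp : 1 < p) {g g' : α → ℝ≥0∞} (hg : ∀ x, g x ≤ g' x) :
    lorentzNorm μ p g ≤ lorentzNorm μ p g' := by
  unfold lorentzNorm
  gcongr with l x
  exact hg x

lemma lorentzNorm_le_of_le_const (hp : 1 < p) {g : α → ℝ≥0∞} {H : Set α} {a : ℝ}
    (hsupp : ∀ x, x ∉ H → g x = 0) (hle : ∀ x, g x ≤ ENNReal.ofReal a) :
    lorentzNorm μ p g ≤ ENNReal.ofReal p * (ENNReal.ofReal a * μ H ^ (1 / p)) := by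
  unfold lorentzNorm
  gcongr
  calc ∫⁻ l in Set.Ioi (0 : ℝ), μ {x | ENNReal.ofReal l < g x} ^ (1 / p)
      ≤ ∫⁻ l in Set.Ioi (0 : ℝ), (Set.Iio a).indicator (fun _ => μ H ^ (1 / p)) l := by
        refine setLIntegral_mono' measurableSet_Ioi fun l hl => ?_
        by_cases hla : l < a
        · rw [Set.indicator_of_mem (Set.mem_Iio.2 hla)]
          gcongr
          intro x hx
          by_contra hxH
          simp [hsupp x hxH] at hx
        · have : {x | ENNReal.ofReal l < g x} = ∅ := by
            ext x
            simpa using (hle x).trans (ENNReal.ofReal_le_ofReal (not_lt.1 hla))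
          simp [this, hla, show (0 : ℝ) < p by linarith]
    _ = ENNReal.ofReal a * μ H ^ (1 / p) := by
        rw [lintegral_indicator measurableSet_Iio, setLIntegral_const,
          Measure.restrict_apply measurableSet_Iio, Set.inter_comm, Set.Ioi_inter_Iio, Real.volume_Ioo, sub_zero, mul_comm]

lemma measure_lt_le_of_weakNorm_le (hp : 1 < p) {g : α → ℝ≥0∞} {W l : ℝ}
    (hl : 0 < l) (hg : weakNorm μ p g ≤ ENNReal.ofReal W) :
    μ {x | ENNReal.ofReal l < g x} ≤ ENNReal.ofReal (W / l) ^ p := by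
  have h1 : ENNReal.ofReal l * μ {x | ENNReal.ofReal l < g x} ^ (1 / p) ≤ ENNReal.ofReal W :=
    (le_iSup₂ (f := fun (l : ℝ) (_ : 0 < l) =>
      ENNReal.ofReal l * μ {x | ENNReal.ofReal l < g x} ^ (1 / p)) l hl).trans hg
  have h2 : μ {x | ENNReal.ofReal l < g x} ^ (1 / p) ≤ ENNReal.ofReal (W / l) := by
    rw [ENNReal.ofReal_div_of_pos hl, ENNReal.le_div_iff_mul_le (by simp [hl]) (by simp), mul_comm]
    exact h1
  rw [one_div] at h2
  exact (ENNReal.rpow_inv_le_iff (by linarith)).1 h2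

lemma setLIntegral_enorm_le_of_weakNorm_le (hp : 1 < p) {h : α → ℂ} (hh : Measurable h)
    {W : ℝ} (hW : 0 < W) (hweak : weakNorm μ p (fun x => ‖h x‖ₑ) ≤ ENNReal.ofReal W)
    {G : Set α} (hG0 : μ G ≠ 0) (hG : μ G ≠ ⊤) :
    ∫⁻ x in G, ‖h x‖ₑ ∂μ
      ≤ ENNReal.ofReal (1 + 1 / (p - 1)) * μ G ^ (1 - 1 / p) * ENNReal.ofReal W := by
  obtain ⟨m, hm, hmG⟩ : ∃ m : ℝ, 0 < m ∧ μ G = ENNReal.ofReal m :=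
    ⟨(μ G).toReal, ENNReal.toReal_pos hG0 hG, (ENNReal.ofReal_toReal hG).symm⟩
  have hp1 : 0 < p - 1 := by linarith
  set d : ℝ := W * m ^ (-(1 / p)) with hd
  have hd0 : 0 < d := by positivity
  have hlow : ∫⁻ t in Set.Ioc 0 d, (μ.restrict G) {a | t < ‖h a‖} ≤ ENNReal.ofReal (m * d) := by
    calc ∫⁻ t in Set.Ioc 0 d, (μ.restrict G) {a | t < ‖h a‖}
        ≤ ∫⁻ t in Set.Ioc 0 d, μ G := by
          refine lintegral_mono fun t => ?_
          exact (measure_mono (Set.subset_univ _)).trans_eq (Measure.restrict_apply_univ _)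
      _ = ENNReal.ofReal (m * d) := by
          rw [setLIntegral_const, Real.volume_Ioc, sub_zero, hmG, ENNReal.ofReal_mul hm.le]
  have hhigh : ∫⁻ t in Set.Ioi d, (μ.restrict G) {a | t < ‖h a‖}
      ≤ ENNReal.ofReal (W ^ p * (d ^ (1 - p) / (p - 1))) := by
    calc ∫⁻ t in Set.Ioi d, (μ.restrict G) {a | t < ‖h a‖}
        ≤ ∫⁻ t in Set.Ioi d, ENNReal.ofReal (W ^ p * t ^ (-p)) := by
          refine setLIntegral_mono' measurableSet_Ioi fun t ht => ?_
          have ht0 : 0 < t := hd0.trans ht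
          refine (Measure.restrict_apply_le _ _).trans ?_
          have := measure_lt_le_of_weakNorm_le hp ht0 hweak
          rw [ENNReal.ofReal_rpow_of_pos (by positivity), Real.div_rpow hW.le ht0.le,
            div_eq_mul_inv, ← Real.rpow_neg ht0.le] at this
          refine le_trans (measure_mono fun a ha => ?_) this
          simp only [Set.mem_ofPred_eq, ← ofReal_norm] at ha ⊢
          exact (ENNReal.ofReal_lt_ofReal_iff (ht0.trans ha)).2 ha
      _ = ENNReal.ofReal (∫ t in Set.Ioi d, W ^ p * t ^ (-p)) := by
          rw [ofReal_integral_eq_lintegral_ofReal]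
          · exact (integrableOn_Ioi_rpow_of_lt (by linarith) hd0).const_mul _
          · filter_upwards [ae_restrict_mem measurableSet_Ioi] with t ht
            have ht0 : 0 < t := hd0.trans ht
            simp only [Pi.zero_apply]
            positivity
      _ = ENNReal.ofReal (W ^ p * (d ^ (1 - p) / (p - 1))) := by
          rw [integral_const_mul, integral_Ioi_rpow_of_lt (by linarith) hd0]
          congr 2
          rw [neg_div, ← div_neg]
          congr 2 <;> ring
  have hreal : m * d + W ^ p * (d ^ (1 - p) / (p - 1))
      = (1 + 1 / (p - 1)) * m ^ (1 - 1 / p) * W := by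
    have e1 : m * d = m ^ (1 - 1 / p) * W := by
      rw [hd, sub_eq_add_neg, Real.rpow_add hm, Real.rpow_one]
      ring
    have e2 : W ^ p * d ^ (1 - p) = m ^ (1 - 1 / p) * W := by
      rw [hd, Real.mul_rpow hW.le (by positivity), ← Real.rpow_mul hm.le, ← mul_assoc,
        ← Real.rpow_add hW, mul_comm]
      congr 1
      · congr 1
        field_simp
        ring
      · simp
    rw [e1, ← mul_div_assoc, e2]
    ring
  calc ∫⁻ x in G, ‖h x‖ₑ ∂μ
      = ∫⁻ x in G, ENNReal.ofReal ‖h x‖ ∂μ := by simp only [ofReal_norm]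
    _ = ∫⁻ t in Set.Ioi 0, (μ.restrict G) {a | t < ‖h a‖} :=
        lintegral_eq_lintegral_meas_lt _ (Filter.Eventually.of_forall fun x => norm_nonneg _)
          hh.norm.aemeasurable
    _ = (∫⁻ t in Set.Ioc 0 d, (μ.restrict G) {a | t < ‖h a‖})
          + ∫⁻ t in Set.Ioi d, (μ.restrict G) {a | t < ‖h a‖} := by
        rw [← Set.Ioc_union_Ioi_eq_Ioi hd0.le,
          lintegral_union measurableSet_Ioi Set.Ioc_disjoint_Ioi_same]
    _ ≤ ENNReal.ofReal (m * d) + ENNReal.ofReal (W ^ p * (d ^ (1 - p) / (p - 1))) :=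
        add_le_add hlow hhigh
    _ = _ := by
        rw [← ENNReal.ofReal_add (by positivity) (by positivity), hreal, hmG,
          ENNReal.ofReal_rpow_of_pos hm, ← ENNReal.ofReal_mul (by positivity),
          ← ENNReal.ofReal_mul (by positivity)]

lemma setLIntegral_enorm_le_weakNorm (hp : 1 < p) {h : α → ℂ} (hh : Measurable h)
    {G : Set α} (hG : μ G ≠ ⊤) :
    ∫⁻ x in G, ‖h x‖ₑ ∂μ
      ≤ ENNReal.ofReal (1 + 1 / (p - 1)) * μ G ^ (1 - 1 / p) * weakNorm μ p (fun x => ‖h x‖ₑ) := by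
  by_cases hG0 : μ G = 0
  · rw [Measure.restrict_eq_zero.2 hG0]
    simp
  have hp1 : 0 < p - 1 := by linarith
  have hexp : 0 < 1 - 1 / p := by
    rw [sub_pos, div_lt_one (by linarith)]
    exact hp
  set D := ENNReal.ofReal (1 + 1 / (p - 1)) * μ G ^ (1 - 1 / p)
  have hD0 : D ≠ 0 := mul_ne_zero (by simp; positivity) (by simp [hG0, hG])
  have hDt : D ≠ ⊤ := ENNReal.mul_ne_top ENNReal.ofReal_ne_top
    (ENNReal.rpow_ne_top_of_nonneg hexp.le hG)
  rw [mul_comm, ← ENNReal.div_le_iff hD0 hDt]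
  refine le_of_forall_gt_imp_ge_of_dense fun b hb => ?_
  by_cases hbt : b = ⊤
  · simp [hbt]
  rw [ENNReal.div_le_iff hD0 hDt, mul_comm]
  have hb0 : 0 < b.toReal := ENNReal.toReal_pos (pos_of_gt hb).ne' hbt
  have := setLIntegral_enorm_le_of_weakNorm_le hp hh hb0
    (by rw [ENNReal.ofReal_toReal hbt]; exact hb.le) hG0 hG
  rwa [ENNReal.ofReal_toReal hbt] at this

end LorentzNorms

section Operators

variable {Ω Ω' : Type*} [MeasurableSpace Ω] [MeasurableSpace Ω'] {μ : Measure Ω} {ν : Measure Ω'}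
  {p q c K : ℝ} {T : ℕ → (Ω → ℂ) → (Ω' → ℂ)} {N : ℕ}

lemma setLIntegral_partialLq_add_le (hq : 1 < q)
    (hTm : ∀ (k : ℕ) (f : Ω → ℂ), Measurable f → Measurable (T k f))
    (hsub : ∀ (k : ℕ) (f g : Ω → ℂ), Measurable f → Measurable g →
      ∀ᵐ x ∂ν, ‖T k (f + g) x‖ ≤ ‖T k f x‖ + ‖T k g x‖)
    {u v : ℕ → Ω → ℂ} (hu : ∀ k, Measurable (u k)) (hv : ∀ k, Measurable (v k)) (G : Set Ω') :
    ∫⁻ x in G, partialLq q N (fun k => T k (u k + v k)) x ∂ν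
      ≤ ∫⁻ x in G, partialLq q N (fun k => T k (u k)) x ∂ν
        + ∫⁻ x in G, partialLq q N (fun k => T k (v k)) x ∂ν := by
  rw [← lintegral_add_left (measurable_partialLq fun k => hTm k _ (hu k))]
  refine lintegral_mono_ae (ae_restrict_of_ae ?_)
  filter_upwards [ae_all_iff.2 fun k => hsub k _ _ (hu k) (hv k)] with x hx
  exact partialLq_le_add hq hx

lemma setLIntegral_partialLq_indicator_union_le (hq : 1 < q)
    (hTm : ∀ (k : ℕ) (f : Ω → ℂ), Measurable f → Measurable (T k f))
    (hsub : ∀ (k : ℕ) (f g : Ω → ℂ), Measurable f → Measurable g →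
      ∀ᵐ x ∂ν, ‖T k (f + g) x‖ ≤ ‖T k f x‖ + ‖T k g x‖)
    {f : ℕ → Ω → ℂ} (hf : ∀ k, Measurable (f k)) {S S' : Set Ω} (hS : MeasurableSet S)
    (hS' : MeasurableSet S') (hd : Disjoint S S') (G : Set Ω') :
    ∫⁻ x in G, partialLq q N (fun k => T k ((S ∪ S').indicator (f k))) x ∂ν
      ≤ ∫⁻ x in G, partialLq q N (fun k => T k (S.indicator (f k))) x ∂ν
        + ∫⁻ x in G, partialLq q N (fun k => T k (S'.indicator (f k))) x ∂ν := by
  have h : ∀ k, (S ∪ S').indicator (f k) = S.indicator (f k) + S'.indicator (f k) :=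
    fun k => Set.indicator_union_of_disjoint hd (f k)
  simp only [h]
  exact setLIntegral_partialLq_add_le hq hTm hsub (fun k => (hf k).indicator hS)
    (fun k => (hf k).indicator hS') G

/-- The bounds on the single operators give a bound on finitely many of them, with a constant
about which nothing is known except that it is finite. -/
lemma exists_setLIntegral_partialLq_le (hp : 1 < p) (hq : 1 < q)
    (hTm : ∀ (k : ℕ) (f : Ω → ℂ), Measurable f → Measurable (T k f))
    (hbdd : ∀ k : ℕ, ∃ B : ℝ≥0∞, B ≠ ⊤ ∧ ∀ f : Ω → ℂ, Measurable f →
      weakNorm ν p (fun x => ‖T k f x‖ₑ) ≤ B * lorentzNorm μ p (fun x => ‖f x‖ₑ)) (N : ℕ) :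
    ∃ D : ℝ≥0∞, D ≠ ⊤ ∧ ∀ (G : Set Ω'), ν G ≠ ⊤ → ∀ f : ℕ → Ω → ℂ, (∀ k, Measurable (f k)) →
      ∀ g : Ω → ℝ≥0∞, (∀ x, partialLq q N f x ≤ g x) →
        ∫⁻ x in G, partialLq q N (fun k => T k (f k)) x ∂ν
          ≤ D * (ν G ^ (1 - 1 / p) * lorentzNorm μ p g) := by
  choose B hB hTB using hbdd
  refine ⟨∑ k ∈ Finset.range N, ENNReal.ofReal (1 + 1 / (p - 1)) * B k,
    ENNReal.sum_ne_top.2 fun k _ => ENNReal.mul_ne_top ENNReal.ofReal_ne_top (hB k), ?_⟩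
  intro G hG f hf g hg
  calc ∫⁻ x in G, partialLq q N (fun k => T k (f k)) x ∂ν
      ≤ ∫⁻ x in G, ∑ k ∈ Finset.range N, ‖T k (f k) x‖ₑ ∂ν :=
        lintegral_mono fun x => partialLq_le_sum hq _ x
    _ = ∑ k ∈ Finset.range N, ∫⁻ x in G, ‖T k (f k) x‖ₑ ∂ν :=
        lintegral_finsetSum _ fun k _ => (hTm k _ (hf k)).enorm
    _ ≤ ∑ k ∈ Finset.range N, ENNReal.ofReal (1 + 1 / (p - 1)) * B k
          * (ν G ^ (1 - 1 / p) * lorentzNorm μ p g) := by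
        refine Finset.sum_le_sum fun k hk => ?_
        calc ∫⁻ x in G, ‖T k (f k) x‖ₑ ∂ν
            ≤ ENNReal.ofReal (1 + 1 / (p - 1)) * ν G ^ (1 - 1 / p)
                * weakNorm ν p (fun x => ‖T k (f k) x‖ₑ) :=
              setLIntegral_enorm_le_weakNorm hp (hTm k _ (hf k)) hG
          _ ≤ ENNReal.ofReal (1 + 1 / (p - 1)) * ν G ^ (1 - 1 / p)
                * (B k * lorentzNorm μ p g) := by
              gcongr
              refine (hTB k _ (hf k)).trans ?_
              gcongr
              exact lorentzNorm_mono hp fun x =>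
                (enorm_le_partialLq hq f x (Finset.mem_range.1 hk)).trans (hg x)
          _ = _ := by ring
    _ = _ := by rw [Finset.sum_mul]

/-- The dualized restricted-type estimate with constant `A` for the first `N` operators. -/
def RestrictedBound (μ : Measure Ω) (ν : Measure Ω') (p q : ℝ) (T : ℕ → (Ω → ℂ) → (Ω' → ℂ))
    (N : ℕ) (A : ℝ≥0∞) : Prop :=
  ∀ (H : Set Ω) (G : Set Ω'), MeasurableSet H → MeasurableSet G → μ H ≠ ⊤ → ν G ≠ ⊤ →
    ∀ f : ℕ → Ω → ℂ, (∀ k, Measurable (f k)) → (∀ k, Function.support (f k) ⊆ H) →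
      ∀ a : ℝ, (∀ x, partialLq q N f x ≤ ENNReal.ofReal a) →
        ∫⁻ x in G, partialLq q N (fun k => T k (f k)) x ∂ν
          ≤ A * (ENNReal.ofReal a * (ν G ^ (1 - 1 / p) * μ H ^ (1 / p)))

lemma exists_restrictedBound (hp : 1 < p) (hq : 1 < q)
    (hTm : ∀ (k : ℕ) (f : Ω → ℂ), Measurable f → Measurable (T k f))
    (hbdd : ∀ k : ℕ, ∃ B : ℝ≥0∞, B ≠ ⊤ ∧ ∀ f : Ω → ℂ, Measurable f →
      weakNorm ν p (fun x => ‖T k f x‖ₑ) ≤ B * lorentzNorm μ p (fun x => ‖f x‖ₑ)) (N : ℕ) :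
    ∃ A : ℝ≥0∞, A ≠ ⊤ ∧ RestrictedBound μ ν p q T N A := by
  obtain ⟨D, hD, hDT⟩ := exists_setLIntegral_partialLq_le hp hq hTm hbdd N
  refine ⟨D * ENNReal.ofReal p, ENNReal.mul_ne_top hD ENNReal.ofReal_ne_top, ?_⟩
  intro H G _ _ _ hG f hf hsupp a ha
  calc ∫⁻ x in G, partialLq q N (fun k => T k (f k)) x ∂ν
      ≤ D * (ν G ^ (1 - 1 / p) * lorentzNorm μ p (partialLq q N f)) :=
        hDT G hG f hf _ fun _ => le_rfl
    _ ≤ D * (ν G ^ (1 - 1 / p) * (ENNReal.ofReal p * (ENNReal.ofReal a * μ H ^ (1 / p)))) := by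
        gcongr
        exact lorentzNorm_le_of_le_const hp
          (fun x hx => partialLq_eq_zero_of_notMem hq hsupp hx) ha
    _ = _ := by ring

/-- The restricted estimate on the major subsets, by Hölder's inequality. -/
lemma setLIntegral_partialLq_le_of_localized (hq : 1 < q)
    (hTm : ∀ (k : ℕ) (f : Ω → ℂ), Measurable f → Measurable (T k f))
    {H H' : Set Ω} {G G' : Set Ω'} (hH'm : MeasurableSet H') (hH' : H' ⊆ H) (hG' : G' ⊆ G)
    (hH0 : μ H ≠ 0) (hH : μ H ≠ ⊤) (hG0 : ν G ≠ 0) (hG : ν G ≠ ⊤)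
    (hloc : ∀ (k : ℕ) (f : Ω → ℂ), Measurable f → Function.support f ⊆ H' →
      (∫⁻ x in G', ‖T k f x‖ₑ ^ q ∂ν) ^ (1 / q)
        ≤ ENNReal.ofReal K * (ν G / μ H) ^ (1 / q - 1 / p)
          * (∫⁻ x, ‖f x‖ₑ ^ q ∂μ) ^ (1 / q))
    {f : ℕ → Ω → ℂ} (hf : ∀ k, Measurable (f k)) (hsupp : ∀ k, Function.support (f k) ⊆ H')
    {a : ℝ} (ha : ∀ x, partialLq q N f x ≤ ENNReal.ofReal a) :
    ∫⁻ x in G', partialLq q N (fun k => T k (f k)) x ∂ν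
      ≤ ENNReal.ofReal K * (ENNReal.ofReal a * (ν G ^ (1 - 1 / p) * μ H ^ (1 / p))) := by
  have hq0 : 0 < q := by linarith
  have hqi : 1 / q < 1 := by rw [div_lt_one hq0]; exact hq
  set R := ENNReal.ofReal K * (ν G / μ H) ^ (1 / q - 1 / p) with hR
  set F := partialLq q N (fun k => T k (f k)) with hF
  have hFm : Measurable F := measurable_partialLq fun k => hTm k _ (hf k)
  have hholder : ∫⁻ x in G', F x ∂ν
      ≤ (∫⁻ x in G', F x ^ q ∂ν) ^ (1 / q) * ν G' ^ (1 - 1 / q) := by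
    have hconj := Real.HolderConjugate.conjExponent hq
    have := ENNReal.lintegral_mul_le_Lp_mul_Lq (ν.restrict G') hconj hFm.aemeasurable
      (aemeasurable_const (b := (1 : ℝ≥0∞)))
    have he : 1 / q.conjExponent = 1 - 1 / q := by
      have := hconj.inv_add_inv_eq_one
      rw [one_div, one_div]
      linarith
    simpa [he] using this
  have hsingle : ∀ k, ∫⁻ x in G', ‖T k (f k) x‖ₑ ^ q ∂ν ≤ R ^ q * ∫⁻ x, ‖f k x‖ₑ ^ q ∂μ := by
    intro k
    have := hloc k (f k) (hf k) (hsupp k)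
    nth_rewrite 1 [one_div] at this
    have := (ENNReal.rpow_inv_le_iff hq0).1 this
    rwa [ENNReal.mul_rpow_of_nonneg _ _ hq0.le, ← ENNReal.rpow_mul, one_div_mul_cancel hq0.ne',
      ENNReal.rpow_one] at this
  have hpow : ∫⁻ x in G', F x ^ q ∂ν ≤ (R * ENNReal.ofReal a) ^ q * μ H := by
    calc ∫⁻ x in G', F x ^ q ∂ν
        = ∑ k ∈ Finset.range N, ∫⁻ x in G', ‖T k (f k) x‖ₑ ^ q ∂ν := by
          simp only [hF, partialLq_rpow hq]
          exact lintegral_finsetSum _ fun k _ => (hTm k _ (hf k)).enorm.pow_const q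
      _ ≤ ∑ k ∈ Finset.range N, R ^ q * ∫⁻ x, ‖f k x‖ₑ ^ q ∂μ :=
          Finset.sum_le_sum fun k _ => hsingle k
      _ = R ^ q * ∫⁻ x, partialLq q N f x ^ q ∂μ := by
          simp only [partialLq_rpow hq]
          rw [← Finset.mul_sum, lintegral_finsetSum _ fun k _ => (hf k).enorm.pow_const q]
      _ ≤ R ^ q * ∫⁻ x, H'.indicator (fun _ => ENNReal.ofReal a ^ q) x ∂μ := by
          gcongr with x
          by_cases hx : x ∈ H'
          · rw [Set.indicator_of_mem hx]
            gcongr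
            exact ha x
          · rw [partialLq_eq_zero_of_notMem hq hsupp hx, ENNReal.zero_rpow_of_pos hq0]
            exact zero_le
      _ ≤ (R * ENNReal.ofReal a) ^ q * μ H := by
          rw [lintegral_indicator hH'm, setLIntegral_const,
            ENNReal.mul_rpow_of_nonneg R (ENNReal.ofReal a) hq0.le, mul_assoc]
          gcongr
  calc ∫⁻ x in G', F x ∂ν
      ≤ ((R * ENNReal.ofReal a) ^ q * μ H) ^ (1 / q) * ν G ^ (1 - 1 / q) := by
        refine hholder.trans ?_
        gcongr
    _ = ENNReal.ofReal K * (ENNReal.ofReal a * ((ν G / μ H) ^ (1 / q - 1 / p) * μ H ^ (1 / q)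
          * ν G ^ (1 - 1 / q))) := by
        rw [ENNReal.mul_rpow_of_nonneg _ _ (by positivity), ← ENNReal.rpow_mul,
          mul_one_div_cancel hq0.ne', ENNReal.rpow_one, hR]
        ring
    _ = _ := by
        congr 2
        rw [div_eq_mul_inv, ENNReal.mul_rpow_of_ne_top hG (ENNReal.inv_ne_top.2 hH0),
          ENNReal.inv_rpow, ← ENNReal.rpow_neg, mul_assoc (ν G ^ _), ← ENNReal.rpow_add _ _ hH0 hH,
          mul_right_comm, ← ENNReal.rpow_add _ _ hG0 hG]
        congr 2 <;> ring

/-- The localization hypothesis: every pair of sets of finite positive measure has major subsets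
on which the scalar operators satisfy the rescaled `L^q` bound uniformly. -/
def LocalizedBound (μ : Measure Ω) (ν : Measure Ω') (p q c K : ℝ)
    (T : ℕ → (Ω → ℂ) → (Ω' → ℂ)) : Prop :=
  ∀ (H : Set Ω) (G : Set Ω'), MeasurableSet H → MeasurableSet G →
    0 < μ H → μ H < ⊤ → 0 < ν G → ν G < ⊤ →
    ∃ (H' : Set Ω) (G' : Set Ω'), H' ⊆ H ∧ G' ⊆ G ∧
      MeasurableSet H' ∧ MeasurableSet G' ∧
      (ν (G \ G') / ν G) ^ (1 - 1 / p) + (μ (H \ H') / μ H) ^ (1 / p) ≤ ENNReal.ofReal c ∧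
      ∀ (k : ℕ) (f : Ω → ℂ), Measurable f → Function.support f ⊆ H' →
        (∫⁻ x in G', ‖T k f x‖ₑ ^ q ∂ν) ^ (1 / q)
          ≤ ENNReal.ofReal K * (ν G / μ H) ^ (1 / q - 1 / p)
            * (∫⁻ x, ‖f x‖ₑ ^ q ∂μ) ^ (1 / q)

lemma RestrictedBound.improve (hp : 1 < p) (hq : 1 < q)
    (hTm : ∀ (k : ℕ) (f : Ω → ℂ), Measurable f → Measurable (T k f))
    (hsub : ∀ (k : ℕ) (f g : Ω → ℂ), Measurable f → Measurable g →
      ∀ᵐ x ∂ν, ‖T k (f + g) x‖ ≤ ‖T k f x‖ + ‖T k g x‖)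
    (hloc : LocalizedBound μ ν p q c K T) {A : ℝ≥0∞} (hA : RestrictedBound μ ν p q T N A) :
    RestrictedBound μ ν p q T N (ENNReal.ofReal c * A + ENNReal.ofReal K) := by
  have hp0 : 0 < p := by linarith
  have hexp : 0 < 1 - 1 / p := by
    rw [sub_pos, div_lt_one hp0]
    exact hp
  have hpi : 0 < 1 / p := by positivity
  intro H G hHm hGm hH hG f hf hsupp a ha
  by_cases hdeg : μ H = 0 ∨ ν G = 0
  · refine (hA H G hHm hGm hH hG f hf hsupp a ha).trans (le_of_eq_of_le ?_ zero_le)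
    rcases hdeg with h | h
    · rw [h, ENNReal.zero_rpow_of_pos hpi]
      simp
    · rw [h, ENNReal.zero_rpow_of_pos hexp]
      simp
  obtain ⟨hH0, hG0⟩ := not_or.1 hdeg
  obtain ⟨H', G', hH', hG', hH'm, hG'm, hc, hb⟩ := hloc H G hHm hGm
    (pos_iff_ne_zero.2 hH0) (lt_top_iff_ne_top.2 hH) (pos_iff_ne_zero.2 hG0)
    (lt_top_iff_ne_top.2 hG)
  have hind : ∀ (S : Set Ω) (x : Ω),
      partialLq q N (fun k => S.indicator (f k)) x ≤ ENNReal.ofReal a := fun S x =>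
    (partialLq_mono hq fun k => enorm_indicator_le_enorm_self _ _).trans (ha x)
  have hsplit : ∀ k, T k (f k) = T k ((H' ∪ H \ H').indicator (f k)) := by
    intro k
    rw [Set.union_sdiff_cancel hH', Set.indicator_eq_self.2 (hsupp k)]
  have hX : ν G ^ (1 - 1 / p) * (ν (G \ G') / ν G) ^ (1 - 1 / p) = ν (G \ G') ^ (1 - 1 / p) := by
    rw [← ENNReal.mul_rpow_of_nonneg _ _ hexp.le, ENNReal.mul_div_cancel hG0 hG]
  have hY : μ H ^ (1 / p) * (μ (H \ H') / μ H) ^ (1 / p) = μ (H \ H') ^ (1 / p) := by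
    rw [← ENNReal.mul_rpow_of_nonneg _ _ hpi.le, ENNReal.mul_div_cancel hH0 hH]
  calc ∫⁻ x in G, partialLq q N (fun k => T k (f k)) x ∂ν
      = ∫⁻ x in G', partialLq q N (fun k => T k (f k)) x ∂ν
          + ∫⁻ x in G \ G', partialLq q N (fun k => T k (f k)) x ∂ν := by
        rw [← lintegral_union (hGm.diff hG'm) Set.disjoint_sdiff_right, Set.union_sdiff_cancel hG']
    _ ≤ (ENNReal.ofReal K * (ENNReal.ofReal a * (ν G ^ (1 - 1 / p) * μ H ^ (1 / p)))
          + A * (ENNReal.ofReal a * (ν G ^ (1 - 1 / p) * μ (H \ H') ^ (1 / p))))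
        + A * (ENNReal.ofReal a * (ν (G \ G') ^ (1 - 1 / p) * μ H ^ (1 / p))) := by
        gcongr
        · simp only [hsplit]
          refine (setLIntegral_partialLq_indicator_union_le hq hTm hsub hf hH'm (hHm.diff hH'm)
            Set.disjoint_sdiff_right G').trans (add_le_add ?_ ?_)
          · exact setLIntegral_partialLq_le_of_localized hq hTm hH'm hH' hG' hH0 hH hG0 hG hb
              (fun k => (hf k).indicator hH'm) (fun k => Set.support_indicator_subset) (hind H')
          · refine (lintegral_mono_set hG').trans ?_
            exact hA (H \ H') G (hHm.diff hH'm) hGm (measure_ne_top_of_subset Set.sdiff_subset hH)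
              hG _ (fun k => (hf k).indicator (hHm.diff hH'm))
              (fun k => Set.support_indicator_subset) a (hind _)
        · exact hA H (G \ G') hHm (hGm.diff hG'm) hH (measure_ne_top_of_subset Set.sdiff_subset hG)
            f hf hsupp a ha
    _ = (((ν (G \ G') / ν G) ^ (1 - 1 / p) + (μ (H \ H') / μ H) ^ (1 / p)) * A
          + ENNReal.ofReal K) * (ENNReal.ofReal a * (ν G ^ (1 - 1 / p) * μ H ^ (1 / p))) := by
        rw [← hX, ← hY]
        ring
    _ ≤ _ := by gcongr

lemma RestrictedBound.of_localizedBound (hp : 1 < p) (hq : 1 < q) (hc0 : 0 ≤ c) (hc1 : c < 1)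
    (hK : 0 ≤ K)
    (hTm : ∀ (k : ℕ) (f : Ω → ℂ), Measurable f → Measurable (T k f))
    (hsub : ∀ (k : ℕ) (f g : Ω → ℂ), Measurable f → Measurable g →
      ∀ᵐ x ∂ν, ‖T k (f + g) x‖ ≤ ‖T k f x‖ + ‖T k g x‖)
    (hbdd : ∀ k : ℕ, ∃ B : ℝ≥0∞, B ≠ ⊤ ∧ ∀ f : Ω → ℂ, Measurable f →
      weakNorm ν p (fun x => ‖T k f x‖ₑ) ≤ B * lorentzNorm μ p (fun x => ‖f x‖ₑ))
    (hloc : LocalizedBound μ ν p q c K T) (N : ℕ) :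
    RestrictedBound μ ν p q T N (ENNReal.ofReal (K / (1 - c))) := by
  have hexp : 0 ≤ 1 - 1 / p := by
    rw [sub_nonneg, div_le_one (by linarith)]
    exact hp.le
  have hc : 0 < 1 - c := by linarith
  obtain ⟨A, hAt, hA⟩ := exists_restrictedBound (q := q) hp hq hTm hbdd N
  have hiter : ∀ n : ℕ,
      RestrictedBound μ ν p q T N (ENNReal.ofReal (c ^ n * A.toReal + K / (1 - c))) := by
    intro n
    induction n with
    | zero =>
      intro H G hHm hGm hH hG f hf hsupp a ha
      refine (hA H G hHm hGm hH hG f hf hsupp a ha).trans ?_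
      gcongr
      rw [← ENNReal.ofReal_toReal hAt]
      apply ENNReal.ofReal_le_ofReal
      rw [ENNReal.toReal_ofReal ENNReal.toReal_nonneg, pow_zero, one_mul]
      exact le_add_of_nonneg_right (by positivity)
    | succ n ih =>
      have := ih.improve hp hq hTm hsub hloc
      have hA0 : 0 ≤ A.toReal := ENNReal.toReal_nonneg
      rw [← ENNReal.ofReal_mul hc0, ← ENNReal.ofReal_add (by positivity) hK] at this
      convert this using 2
      field_simp
      ring
  intro H G hHm hGm hH hG f hf hsupp a ha
  have hlim : Filter.Tendsto (fun n : ℕ => c ^ n * A.toReal + K / (1 - c)) Filter.atTop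
      (nhds (K / (1 - c))) := by
    simpa using ((tendsto_pow_atTop_nhds_zero_of_lt_one hc0 hc1).mul_const A.toReal).add_const
      (K / (1 - c))
  exact ge_of_tendsto' (ENNReal.Tendsto.mul_const (ENNReal.tendsto_ofReal hlim)
    (Or.inr <| ENNReal.mul_ne_top ENNReal.ofReal_ne_top <| ENNReal.mul_ne_top
      (ENNReal.rpow_ne_top_of_nonneg hexp hG) (ENNReal.rpow_ne_top_of_nonneg (by positivity) hH)))
    fun n => hiter n H G hHm hGm hH hG f hf hsupp a ha

end Operators

section Layers

variable {α : Type*} [MeasurableSpace α] {μ : Measure α} {p : ℝ}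

lemma ofReal_sub_mul_measure_rpow_le (hp : 1 < p) (g : α → ℝ≥0∞) (s l : ℝ) :
    ENNReal.ofReal (l - s) * μ {x | ENNReal.ofReal l < g x} ^ (1 / p)
      ≤ ∫⁻ t in Set.Ioc s l, μ {x | ENNReal.ofReal t < g x} ^ (1 / p) := by
  rw [← Real.volume_Ioc, mul_comm, ← setLIntegral_const]
  refine setLIntegral_mono' measurableSet_Ioc fun t ht => ?_
  gcongr with x
  exact ht.2

lemma lintegral_distribution_le_lorentzNorm (hp : 1 < p) (g : α → ℝ≥0∞) :
    ∫⁻ l in Set.Ioi (0 : ℝ), μ {x | ENNReal.ofReal l < g x} ^ (1 / p) ≤ lorentzNorm μ p g := by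
  refine le_mul_of_one_le_left zero_le ?_
  rw [← ENNReal.ofReal_one]
  exact ENNReal.ofReal_le_ofReal hp.le

lemma measure_lt_ne_top_of_lorentzNorm_ne_top (hp : 1 < p) {g : α → ℝ≥0∞}
    (hg : lorentzNorm μ p g ≠ ⊤) {l : ℝ} (hl : 0 < l) : μ {x | ENNReal.ofReal l < g x} ≠ ⊤ := by
  intro htop
  have h := (ofReal_sub_mul_measure_rpow_le (μ := μ) hp g 0 l).trans
    ((lintegral_mono_set Set.Ioc_subset_Ioi_self).trans
      (lintegral_distribution_le_lorentzNorm hp g))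
  rw [htop, ENNReal.top_rpow_of_pos (by positivity), ENNReal.mul_top (by simpa using hl)] at h
  exact hg (top_le_iff.1 h)

lemma measure_eq_top_of_lorentzNorm_ne_top (hp : 1 < p) {g : α → ℝ≥0∞}
    (hg : lorentzNorm μ p g ≠ ⊤) : μ {x | g x = ⊤} = 0 := by
  by_contra h0
  have hp0 : 0 < p := by linarith
  have h : ∫⁻ _ in Set.Ioi (0 : ℝ), μ {x | g x = ⊤} ^ (1 / p) ≤ lorentzNorm μ p g := by
    refine le_trans (lintegral_mono fun l => ?_) (lintegral_distribution_le_lorentzNorm hp g)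
    gcongr with x
    intro hx
    simp [hx]
  rw [setLIntegral_const, Real.volume_Ioi, ENNReal.mul_top (by simp [h0, hp0.le])] at h
  exact hg (top_le_iff.1 h)

lemma tendsto_lorentzNorm_indicator (hp : 1 < p) {g : α → ℝ≥0∞} (hgm : Measurable g)
    (hg : lorentzNorm μ p g ≠ ⊤) {E : ℕ → Set α} (hEm : ∀ n, MeasurableSet (E n))
    (hE : Antitone E) (hlim : ∀ x, (∀ n, x ∈ E n) → g x = 0 ∨ g x = ⊤) :
    Filter.Tendsto (fun n => lorentzNorm μ p ((E n).indicator g)) Filter.atTop (nhds 0) := by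
  have hp0 : 0 < p := by linarith
  have hpi : 0 < 1 / p := by positivity
  have hset : ∀ (n : ℕ) (l : ℝ), {x | ENNReal.ofReal l < (E n).indicator g x}
      = E n ∩ {x | ENNReal.ofReal l < g x} := by
    intro n l
    ext x
    by_cases hx : x ∈ E n <;> simp [hx]
  have hint : Filter.Tendsto (fun n => ∫⁻ l in Set.Ioi (0 : ℝ),
      μ {x | ENNReal.ofReal l < (E n).indicator g x} ^ (1 / p)) Filter.atTop
      (nhds (∫⁻ _ in Set.Ioi (0 : ℝ), 0)) := by
    refine tendsto_lintegral_of_dominated_convergence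
      (fun l => μ {x | ENNReal.ofReal l < g x} ^ (1 / p))
      (fun n => measurable_distribution_rpow hp _)
      (fun n => Filter.Eventually.of_forall fun l => ?_)
      (ne_top_of_le_ne_top hg (lintegral_distribution_le_lorentzNorm hp g)) ?_
    · dsimp only
      rw [hset]
      gcongr
      exact Set.inter_subset_right
    · filter_upwards [ae_restrict_mem measurableSet_Ioi] with l hl
      have hconv := tendsto_measure_iInter_atTop (μ := μ)
        (s := fun n => E n ∩ {x | ENNReal.ofReal l < g x})
        (fun n => ((hEm n).inter (measurableSet_lt measurable_const hgm)).nullMeasurableSet)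
        (fun m n hmn => Set.inter_subset_inter_left _ (hE hmn))
        ⟨0, measure_ne_top_of_subset Set.inter_subset_right
          (measure_lt_ne_top_of_lorentzNorm_ne_top hp hg hl)⟩
      have hzero : μ (⋂ n, E n ∩ {x | ENNReal.ofReal l < g x}) = 0 := by
        refine measure_mono_null (fun x hx => ?_) (measure_eq_top_of_lorentzNorm_ne_top hp hg)
        rw [Set.mem_iInter] at hx
        rcases hlim x fun n => (hx n).1 with h | h
        · have := (hx 0).2
          simp [h] at this
        · exact h
      rw [hzero] at hconv
      have := (ENNReal.continuous_rpow_const (y := 1 / p)).tendsto 0 |>.comp hconv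
      rw [ENNReal.zero_rpow_of_pos hpi] at this
      refine this.congr fun n => ?_
      simp only [Function.comp_apply, hset]
  have := ENNReal.Tendsto.const_mul (a := ENNReal.ofReal p) hint (Or.inr ENNReal.ofReal_ne_top)
  simpa [lorentzNorm] using this

lemma ge_of_forall_setLIntegral_le (hp : 1 < p) {F : α → ℝ≥0∞} {S : Set α} (hS : μ S ≠ ⊤)
    (hSm : MeasurableSet S) {l : ℝ} {Z : ℝ≥0∞} (hlt : ∀ x ∈ S, ENNReal.ofReal l ≤ F x)
    (hF : ∫⁻ x in S, F x ∂μ ≤ μ S ^ (1 - 1 / p) * Z) :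
    ENNReal.ofReal l * μ S ^ (1 / p) ≤ Z := by
  have hp0 : 0 < p := by linarith
  by_cases hS0 : μ S = 0
  · simp [hS0, hp0]
  have h1 : ENNReal.ofReal l * μ S ≤ μ S ^ (1 - 1 / p) * Z := by
    rw [← setLIntegral_const]
    exact (setLIntegral_mono' hSm hlt).trans hF
  have h2 : μ S ^ (1 - 1 / p) * μ S ^ (1 / p) = μ S := by
    rw [← ENNReal.rpow_add _ _ hS0 hS, sub_add_cancel, ENNReal.rpow_one]
  have hexp : 0 ≤ 1 - 1 / p := by
    rw [sub_nonneg, div_le_one hp0]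
    exact hp.le
  rw [← ENNReal.mul_le_mul_iff_right (a := μ S ^ (1 - 1 / p)) (by simp [hS0, hS])
    (ENNReal.rpow_ne_top_of_nonneg hexp hS), mul_left_comm, h2]
  exact h1

lemma weakNorm_le_of_tendsto [SigmaFinite μ] (hp : 1 < p) {F : ℕ → α → ℝ≥0∞} {F' : α → ℝ≥0∞}
    {Z : ℝ≥0∞} (hFm : ∀ n, Measurable (F n)) (hmono : ∀ x, Monotone fun n => F n x)
    (hlim : ∀ x, Filter.Tendsto (fun n => F n x) Filter.atTop (nhds (F' x)))
    (hbound : ∀ n (G : Set α), MeasurableSet G → μ G ≠ ⊤ →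
      ∫⁻ x in G, F n x ∂μ ≤ μ G ^ (1 - 1 / p) * Z) :
    weakNorm μ p F' ≤ Z := by
  have hp0 : 0 < p := by linarith
  refine iSup₂_le fun l hl => ?_
  set S : ℕ → Set α := fun n => {x | ENNReal.ofReal l < F n x} ∩ spanningSets μ n with hS
  have hSm : ∀ n, MeasurableSet (S n) := fun n =>
    (measurableSet_lt measurable_const (hFm n)).inter (measurableSet_spanningSets μ n)
  have hSfin : ∀ n, μ (S n) ≠ ⊤ := fun n =>
    measure_ne_top_of_subset Set.inter_subset_right (measure_spanningSets_lt_top μ n).ne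
  have hSmono : Monotone S := fun m n hmn => Set.inter_subset_inter
    (fun x (hx : ENNReal.ofReal l < F m x) => hx.trans_le (hmono x hmn))
    (monotone_spanningSets μ hmn)
  have hsub : {x | ENNReal.ofReal l < F' x} ⊆ ⋃ n, S n := by
    intro x hx
    have hx' : ENNReal.ofReal l < F' x := hx
    have hspan : x ∈ ⋃ n, spanningSets μ n := by
      rw [iUnion_spanningSets]
      trivial
    obtain ⟨m, hm⟩ := Set.mem_iUnion.1 hspan
    obtain ⟨n, hn, hmn⟩ :=
      (((hlim x).eventually_const_lt hx').and (Filter.eventually_ge_atTop m)).exists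
    exact Set.mem_iUnion.2 ⟨n, hn, monotone_spanningSets μ hmn hm⟩
  have hl0 : ENNReal.ofReal l ≠ 0 := by simpa using hl
  have hn : ∀ n, μ (S n) ≤ (Z / ENNReal.ofReal l) ^ p := by
    intro n
    have := ge_of_forall_setLIntegral_le hp (hSfin n) (hSm n) (fun x hx => hx.1.le)
      (hbound n (S n) (hSm n) (hSfin n))
    rw [mul_comm, ← ENNReal.le_div_iff_mul_le (Or.inl hl0) (Or.inl ENNReal.ofReal_ne_top),
      one_div, ENNReal.rpow_inv_le_iff hp0] at this
    exact this
  have hfin : μ {x | ENNReal.ofReal l < F' x} ≤ (Z / ENNReal.ofReal l) ^ p := by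
    refine (measure_mono hsub).trans ?_
    rw [hSmono.measure_iUnion]
    exact iSup_le hn
  rw [mul_comm, ← ENNReal.le_div_iff_mul_le (Or.inl hl0) (Or.inl ENNReal.ofReal_ne_top),
    one_div, ENNReal.rpow_inv_le_iff hp0]
  exact hfin

end Layers

section DyadicDecomposition

variable {Ω Ω' : Type*} [MeasurableSpace Ω] [MeasurableSpace Ω'] {μ : Measure Ω} {ν : Measure Ω'}
  {p q : ℝ} {T : ℕ → (Ω → ℂ) → (Ω' → ℂ)} {N : ℕ}

lemma RestrictedBound.setLIntegral_layers_le (hp : 1 < p) (hq : 1 < q)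
    (hTm : ∀ (k : ℕ) (f : Ω → ℂ), Measurable f → Measurable (T k f))
    (hsub : ∀ (k : ℕ) (f g : Ω → ℂ), Measurable f → Measurable g →
      ∀ᵐ x ∂ν, ‖T k (f + g) x‖ ≤ ‖T k f x‖ + ‖T k g x‖)
    {A : ℝ≥0∞} (hA : RestrictedBound μ ν p q T N A)
    {f : ℕ → Ω → ℂ} (hf : ∀ k, Measurable (f k)) {g : Ω → ℝ≥0∞} (hgm : Measurable g)
    (hfg : ∀ x, partialLq q N f x ≤ g x) (hg : lorentzNorm μ p g ≠ ⊤)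
    {G : Set Ω'} (hGm : MeasurableSet G) (hG : ν G ≠ ⊤) {d : ℝ} (hd : 0 < d) (n : ℕ) :
    ∫⁻ x in G, partialLq q N (fun k => T k ((g ⁻¹' Set.Ioc (ENNReal.ofReal d)
        (ENNReal.ofReal (d * 2 ^ n))).indicator (f k))) x ∂ν
      ≤ 4 * A * (ν G ^ (1 - 1 / p) * ∫⁻ l in Set.Ioc 0 (d * 2 ^ n / 2),
          μ {x | ENNReal.ofReal l < g x} ^ (1 / p)) := by
  have hq0 : 0 < q := by linarith
  induction n with
  | zero =>
    have h := hA ∅ G MeasurableSet.empty hGm (by simp) hG (fun _ => 0) (fun _ => measurable_const)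
      (by simp) 0 (by simp [partialLq, hq0])
    simp only [ENNReal.ofReal_zero, zero_mul, mul_zero] at h
    simp only [pow_zero, mul_one, Set.Ioc_self, Set.preimage_empty, Set.indicator_empty]
    exact h.trans zero_le
  | succ n ih =>
    set M : ℝ := d * 2 ^ n with hM
    have hM0 : 0 < M := by positivity
    have hM2 : d * 2 ^ (n + 1) = 2 * M := by rw [hM]; ring
    have hle1 : ENNReal.ofReal d ≤ ENNReal.ofReal M :=
      ENNReal.ofReal_le_ofReal (le_mul_of_one_le_right hd.le (one_le_pow₀ one_le_two))
    have hle2 : ENNReal.ofReal M ≤ ENNReal.ofReal (2 * M) :=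
      ENNReal.ofReal_le_ofReal (by linarith)
    rw [hM2, ← Set.Ioc_union_Ioc_eq_Ioc hle1 hle2, Set.preimage_union]
    have hnew : ∫⁻ x in G, partialLq q N (fun k => T k ((g ⁻¹' Set.Ioc (ENNReal.ofReal M)
        (ENNReal.ofReal (2 * M))).indicator (f k))) x ∂ν
        ≤ 4 * A * (ν G ^ (1 - 1 / p) * ∫⁻ l in Set.Ioc (M / 2) M,
          μ {x | ENNReal.ofReal l < g x} ^ (1 / p)) := by
      calc ∫⁻ x in G, partialLq q N (fun k => T k ((g ⁻¹' Set.Ioc (ENNReal.ofReal M)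
            (ENNReal.ofReal (2 * M))).indicator (f k))) x ∂ν
          ≤ A * (ENNReal.ofReal (2 * M) * (ν G ^ (1 - 1 / p)
              * μ {x | ENNReal.ofReal M < g x} ^ (1 / p))) := by
            refine hA _ G (measurableSet_lt measurable_const hgm) hGm
              (measure_lt_ne_top_of_lorentzNorm_ne_top hp hg hM0) hG _
              (fun k => (hf k).indicator (hgm measurableSet_Ioc))
              (fun k => Set.support_indicator_subset.trans fun x hx => hx.1) _ fun x => ?_
            by_cases hx : x ∈ g ⁻¹' Set.Ioc (ENNReal.ofReal M) (ENNReal.ofReal (2 * M))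
            · exact (partialLq_mono hq fun k => enorm_indicator_le_enorm_self _ _).trans
                ((hfg x).trans hx.2)
            · rw [partialLq_eq_zero_of_notMem hq (fun k => Set.support_indicator_subset) hx]
              exact zero_le
        _ = 4 * A * (ν G ^ (1 - 1 / p)
              * (ENNReal.ofReal (M - M / 2) * μ {x | ENNReal.ofReal M < g x} ^ (1 / p))) := by
            have : ENNReal.ofReal (2 * M) = 4 * ENNReal.ofReal (M - M / 2) := by
              rw [show (4 : ℝ≥0∞) = ENNReal.ofReal 4 by norm_num,
                ← ENNReal.ofReal_mul (by norm_num)]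
              congr 1
              ring
            rw [this]
            ring
        _ ≤ _ := by
            gcongr
            exact ofReal_sub_mul_measure_rpow_le hp g _ _
    refine (setLIntegral_partialLq_indicator_union_le hq hTm hsub hf (hgm measurableSet_Ioc)
      (hgm measurableSet_Ioc) (Disjoint.preimage g ?_) G).trans ((add_le_add ih hnew).trans_eq ?_)
    · exact Set.Ioc_disjoint_Ioc_of_le le_rfl
    · rw [← mul_add, ← mul_add, ← lintegral_union measurableSet_Ioc
        (Set.Ioc_disjoint_Ioc_of_le le_rfl),
        Set.Ioc_union_Ioc_eq_Ioc (by positivity) (by linarith), mul_div_cancel_left₀ _ two_ne_zero]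

lemma RestrictedBound.setLIntegral_le_lorentzNorm (hp : 1 < p) (hq : 1 < q)
    (hTm : ∀ (k : ℕ) (f : Ω → ℂ), Measurable f → Measurable (T k f))
    (hsub : ∀ (k : ℕ) (f g : Ω → ℂ), Measurable f → Measurable g →
      ∀ᵐ x ∂ν, ‖T k (f + g) x‖ ≤ ‖T k f x‖ + ‖T k g x‖)
    (hbdd : ∀ k : ℕ, ∃ B : ℝ≥0∞, B ≠ ⊤ ∧ ∀ f : Ω → ℂ, Measurable f →
      weakNorm ν p (fun x => ‖T k f x‖ₑ) ≤ B * lorentzNorm μ p (fun x => ‖f x‖ₑ))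
    {A : ℝ≥0∞} (hA : RestrictedBound μ ν p q T N A)
    {f : ℕ → Ω → ℂ} (hf : ∀ k, Measurable (f k)) {g : Ω → ℝ≥0∞} (hgm : Measurable g)
    (hfg : ∀ x, partialLq q N f x ≤ g x) (hg : lorentzNorm μ p g ≠ ⊤)
    {G : Set Ω'} (hGm : MeasurableSet G) (hG : ν G ≠ ⊤) :
    ∫⁻ x in G, partialLq q N (fun k => T k (f k)) x ∂ν
      ≤ 4 * A * (ν G ^ (1 - 1 / p) * lorentzNorm μ p g) := by
  obtain ⟨D, hD, hDT⟩ := exists_setLIntegral_partialLq_le (q := q) hp hq hTm hbdd N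
  have hexp : 0 ≤ 1 - 1 / p := by
    rw [sub_nonneg, div_le_one (by linarith)]
    exact hp.le
  set L : ℕ → Set Ω := fun n =>
    g ⁻¹' Set.Ioc (ENNReal.ofReal ((1 / 2) ^ n)) (ENNReal.ofReal (2 ^ n)) with hL
  have hLm : ∀ n, MeasurableSet (L n) := fun n => hgm measurableSet_Ioc
  have hLmono : Monotone L := fun m n hmn => Set.preimage_mono <| Set.Ioc_subset_Ioc
    (ENNReal.ofReal_le_ofReal (pow_le_pow_of_le_one (by norm_num) (by norm_num) hmn))
    (ENNReal.ofReal_le_ofReal (pow_le_pow_right₀ one_le_two hmn))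
  have hLlim : ∀ x, (∀ n, x ∈ (L n)ᶜ) → g x = 0 ∨ g x = ⊤ := by
    intro x hx
    by_contra! hne
    have hpos : 0 < (g x).toReal := ENNReal.toReal_pos hne.1 hne.2
    obtain ⟨m, hm⟩ := exists_pow_lt_of_lt_one hpos (show (1 / 2 : ℝ) < 1 by norm_num)
    obtain ⟨n, hn⟩ := pow_unbounded_of_one_lt (g x).toReal one_lt_two
    refine hx (max m n) ⟨?_, ?_⟩
    · rw [ENNReal.ofReal_lt_iff_lt_toReal (by positivity) hne.2]
      exact (pow_le_pow_of_le_one (by norm_num) (by norm_num) (le_max_left m n)).trans_lt hm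
    · rw [ENNReal.le_ofReal_iff_toReal_le hne.2 (by positivity)]
      exact hn.le.trans (pow_le_pow_right₀ one_le_two (le_max_right m n))
  have hrest := tendsto_lorentzNorm_indicator hp hgm hg (fun n => (hLm n).compl)
    (fun m n hmn => Set.compl_subset_compl.2 (hLmono hmn)) hLlim
  have hlayers : ∀ n, ∫⁻ x in G, partialLq q N (fun k => T k ((L n).indicator (f k))) x ∂ν
      ≤ 4 * A * (ν G ^ (1 - 1 / p) * lorentzNorm μ p g) := by
    intro n
    have h2 : (2 : ℝ) ^ n = (1 / 2) ^ n * 2 ^ (2 * n) := by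
      rw [pow_mul, ← mul_pow]
      norm_num
    have h := hA.setLIntegral_layers_le hp hq hTm hsub hf hgm hfg hg hGm hG
      (d := (1 / 2) ^ n) (by positivity) (2 * n)
    rw [← h2] at h
    refine h.trans ?_
    gcongr
    exact (lintegral_mono_set Set.Ioc_subset_Ioi_self).trans
      (lintegral_distribution_le_lorentzNorm hp g)
  have hlim : Filter.Tendsto (fun n => 4 * A * (ν G ^ (1 - 1 / p) * lorentzNorm μ p g)
      + D * (ν G ^ (1 - 1 / p) * lorentzNorm μ p ((L n)ᶜ.indicator g))) Filter.atTop
      (nhds (4 * A * (ν G ^ (1 - 1 / p) * lorentzNorm μ p g))) := by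
    have h := ENNReal.Tendsto.const_mul (a := D) (ENNReal.Tendsto.const_mul
      (a := ν G ^ (1 - 1 / p)) hrest (Or.inr (ENNReal.rpow_ne_top_of_nonneg hexp hG)))
      (Or.inr hD)
    rw [mul_zero, mul_zero] at h
    simpa using h.const_add (4 * A * (ν G ^ (1 - 1 / p) * lorentzNorm μ p g))
  refine ge_of_tendsto' hlim fun n => ?_
  have hsplit : ∀ k, T k (f k) = T k ((L n ∪ (L n)ᶜ).indicator (f k)) := by
    intro k
    rw [Set.union_compl_self, Set.indicator_univ]
  simp only [hsplit]
  refine (setLIntegral_partialLq_indicator_union_le hq hTm hsub hf (hLm n) (hLm n).compl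
    disjoint_compl_right G).trans (add_le_add (hlayers n) ?_)
  refine hDT G hG _ (fun k => (hf k).indicator (hLm n).compl) _ fun x => ?_
  by_cases hx : x ∈ (L n)ᶜ
  · rw [Set.indicator_of_mem hx]
    exact (partialLq_mono hq fun k => enorm_indicator_le_enorm_self _ _).trans (hfg x)
  · rw [partialLq_eq_zero_of_notMem hq (fun k => Set.support_indicator_subset) hx]
    exact zero_le

end DyadicDecomposition

/-- **Vector-valued extension of localized restricted type estimates
(Bateman–Thiele technique).** -/
theorem vector_valued_from_localized_estimates
    (p q c K : ℝ) (hp : 1 < p) (hq : 1 < q) (hc0 : 0 ≤ c) (hc1 : c < 1) (hK : 0 ≤ K) :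
    ∃ C : ℝ, 0 < C ∧
      ∀ (Ω Ω' : Type) [MeasurableSpace Ω] [MeasurableSpace Ω']
        (μ : Measure Ω) (ν : Measure Ω') [SigmaFinite μ] [SigmaFinite ν]
        (T : ℕ → (Ω → ℂ) → (Ω' → ℂ)),
        (∀ (k : ℕ) (f : Ω → ℂ), Measurable f → Measurable (T k f)) →
        (∀ (k : ℕ) (f g : Ω → ℂ), Measurable f → Measurable g →
          ∀ᵐ x ∂ν, ‖T k (f + g) x‖ ≤ ‖T k f x‖ + ‖T k g x‖) →
        (∀ k : ℕ, ∃ B : ℝ≥0∞, B ≠ ⊤ ∧ ∀ f : Ω → ℂ, Measurable f →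
          weakNorm ν p (fun x => (‖T k f x‖₊ : ℝ≥0∞))
            ≤ B * lorentzNorm μ p (fun x => (‖f x‖₊ : ℝ≥0∞))) →
        (∀ (H : Set Ω) (G : Set Ω'), MeasurableSet H → MeasurableSet G →
          0 < μ H → μ H < ⊤ → 0 < ν G → ν G < ⊤ →
          ∃ (H' : Set Ω) (G' : Set Ω'), H' ⊆ H ∧ G' ⊆ G ∧
            MeasurableSet H' ∧ MeasurableSet G' ∧
            (ν (G \ G') / ν G) ^ (1 - 1 / p) + (μ (H \ H') / μ H) ^ (1 / p)
              ≤ ENNReal.ofReal c ∧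
            ∀ (k : ℕ) (f : Ω → ℂ), Measurable f → Function.support f ⊆ H' →
              (∫⁻ x in G', (‖T k f x‖₊ : ℝ≥0∞) ^ q ∂ν) ^ (1 / q)
                ≤ ENNReal.ofReal K * (ν G / μ H) ^ (1 / q - 1 / p)
                  * (∫⁻ x, (‖f x‖₊ : ℝ≥0∞) ^ q ∂μ) ^ (1 / q)) →
        ∀ f : ℕ → Ω → ℂ, (∀ k, Measurable (f k)) →
          weakNorm ν p (fun x => (∑' k : ℕ, (‖T k (f k) x‖₊ : ℝ≥0∞) ^ q) ^ (1 / q))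
            ≤ ENNReal.ofReal C
              * lorentzNorm μ p (fun x => (∑' k : ℕ, (‖f k x‖₊ : ℝ≥0∞) ^ q) ^ (1 / q)) := by
  have hA0 : 0 ≤ K / (1 - c) := div_nonneg hK (by linarith)
  have hC : 0 < 4 * (K / (1 - c) + 1) := by positivity
  refine ⟨4 * (K / (1 - c) + 1), hC, ?_⟩
  intro Ω Ω' _ _ μ ν _ _ T hTm hsub hbdd hloc f hf
  set g : Ω → ℝ≥0∞ := fun x => (∑' k : ℕ, (‖f k x‖₊ : ℝ≥0∞) ^ q) ^ (1 / q) with hgdef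
  have hgm : Measurable g :=
    (Measurable.tsum fun k => (hf k).enorm.pow_const q).pow_const _
  by_cases hg : lorentzNorm μ p g = ⊤
  · rw [hg, ENNReal.mul_top (by simpa using hC)]
    exact le_top
  refine weakNorm_le_of_tendsto hp (F := fun N => partialLq q N fun k => T k (f k))
    (fun N => measurable_partialLq fun k => hTm k _ (hf k)) (monotone_partialLq hq _)
    (tendsto_partialLq _) fun N G hGm hG => ?_
  have hA := RestrictedBound.of_localizedBound hp hq hc0 hc1 hK hTm hsub hbdd hloc N
  refine (hA.setLIntegral_le_lorentzNorm hp hq hTm hsub hbdd hf hgm (partialLq_le_tsum hq f) hg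
    hGm hG).trans ?_
  rw [mul_left_comm]
  gcongr
  rw [ENNReal.ofReal_mul (by norm_num)]
  gcongr
  · norm_num
  · linarith
end
end

section
/- Let 𝓡 be a finite collection of parallelograms with vertical edges whose shadows are dyadic intervals. Then there exists a subcollection 𝓖 ⊆ 𝓡 such that: (i) |⋃_{R∈𝓡} R| ≤ C Σ_{R∈𝓖} |R| for an absolute constant C; (ii) for every integer n ≥ 1, Σ |R₁ ∩ ⋯ ∩ Rₙ| ≤ C_n Σ_{R∈𝓖} |R|, where the sum on the left is over all n-tuples (R₁,…,Rₙ) ∈ 𝓖ⁿ with U(R₁) ∩ ⋯ ∩ U(Rₙ) ≠ ∅ and C_n depends only on n; and (iii) for every measurable function u: ℝ² → ℝ and every 0 < q < ∞, ∫_{ℝ²} ( Σ_{R∈𝓖} 1_{E(R)} )^q ≤ C_q Σ_{R∈𝓖} |R|, where C_q depends only on q. -/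
open MeasureTheory
open scoped ENNReal NNReal

noncomputable section

/-- A parallelogram with two vertical edges: shadow (projection to the horizontal axis)
the interval of length `len` centered at `xc`, slope `slope`, height `height`, and central
line passing through `(xc, yc)`. -/
structure Pgram where
  xc : ℝ
  len : ℝ
  height : ℝ
  slope : ℝ
  yc : ℝ
  len_pos : 0 < len
  height_pos : 0 < height

/-- The set of points of a parallelogram with vertical edges. -/
def Pgram.toSet (R : Pgram) : Set (ℝ × ℝ) :=
  {z | |z.1 - R.xc| ≤ R.len / 2 ∧ |z.2 - (R.yc + R.slope * (z.1 - R.xc))| ≤ R.height / 2}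

/-- The area `|R| = |I(R)| · H(R)` of a parallelogram with vertical edges. -/
def Pgram.area (R : Pgram) : ℝ := R.len * R.height

/-- The uncertainty interval `U(R)`: the interval of length `2 H(R)/|I(R)|` centered
at the slope. -/
def Pgram.U (R : Pgram) : Set ℝ :=
  Set.Icc (R.slope - R.height / R.len) (R.slope + R.height / R.len)

/-- `E(R) = {z ∈ R : u(z) ∈ U(R)}`. -/
def Pgram.E (u : ℝ × ℝ → ℝ) (R : Pgram) : Set (ℝ × ℝ) :=
  {z ∈ R.toSet | u z ∈ R.U}

/-- The shadow of `R` is a dyadic interval. -/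
def Pgram.dyadicShadow (R : Pgram) : Prop :=
  ∃ k m : ℤ, R.len = 2 ^ k ∧ R.xc = ((m : ℝ) + 1 / 2) * 2 ^ k

/-! ### Greedy selection and sums over chains -/

open scoped Classical in
/-- Greedy selection: an element is kept as long as its weight exceeds the total weight of the
related elements kept before it. -/
theorem exists_greedy_subset {α : Type*} [LinearOrder α] (rel : α → α → Prop)
    (hrefl : ∀ a, rel a a) (h : α → ℝ) (hh : ∀ a, 0 ≤ h a) (s : Finset α) :
    ∃ G ⊆ s, (∀ a ∈ G, ∑ b ∈ G with b < a ∧ rel b a, h b ≤ h a) ∧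
      ∀ a ∈ s, h a ≤ ∑ b ∈ G with b ≤ a ∧ rel b a, h b := by
  induction s using Finset.induction_on_max with
  | empty => exact ⟨∅, by simp⟩
  | insert a s ha ih =>
    obtain ⟨G, hGs, h1, h2⟩ := ih
    by_cases hc : h a ≤ ∑ b ∈ G with b < a ∧ rel b a, h b
    · refine ⟨G, hGs.trans (Finset.subset_insert _ _), h1, ?_⟩
      intro c hcs
      rcases Finset.mem_insert.1 hcs with rfl | hcs
      · refine hc.trans (Finset.sum_le_sum_of_subset_of_nonneg ?_ fun b _ _ => hh b)
        exact Finset.monotone_filter_right _ fun b _ hb => ⟨hb.1.le, hb.2⟩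
      · exact h2 c hcs
    · refine ⟨insert a G, Finset.insert_subset_insert _ hGs, ?_, ?_⟩
      · intro c hcG
        rcases Finset.mem_insert.1 hcG with rfl | hcG
        · rw [Finset.filter_insert, if_neg (by simp)]
          exact (not_le.1 hc).le
        · rw [Finset.filter_insert, if_neg (fun hac => (hac.1.trans (ha c (hGs hcG))).false)]
          exact h1 c hcG
      · intro c hcs
        rcases Finset.mem_insert.1 hcs with rfl | hcs
        · exact Finset.single_le_sum (f := h) (fun b _ => hh b)
            (Finset.mem_filter.2 ⟨Finset.mem_insert_self _ _, le_rfl, hrefl _⟩)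
        · refine (h2 c hcs).trans (Finset.sum_le_sum_of_subset_of_nonneg ?_ fun b _ _ => hh b)
          exact Finset.filter_subset_filter _ (Finset.subset_insert _ _)

open scoped Classical in
theorem sum_chains_le {α : Type*} (G : Finset α) (step : α → α → Prop) (h l : α → ℝ)
    (hl : ∀ a, 0 ≤ l a)
    (hG : ∀ a ∈ G, ∑ b ∈ G with step b a, h b ≤ 2 * h a) (n : ℕ) :
    ∑ g ∈ Fintype.piFinset (fun _ : Fin (n + 1) => G) with
        ∀ i : Fin n, step (g i.castSucc) (g i.succ), h (g 0) * l (g (Fin.last n))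
      ≤ 2 ^ n * ∑ a ∈ G, h a * l a := by
  induction n with
  | zero =>
    simp only [pow_zero, one_mul, IsEmpty.forall_iff, Finset.filter_true]
    refine le_of_eq (Finset.sum_nbij' (fun g => g 0) (fun a _ => a) ?_ ?_ ?_ ?_ ?_)
    · intro g hg; exact Fintype.mem_piFinset.1 hg 0
    · intro a ha; exact Fintype.mem_piFinset.2 fun _ => ha
    · intro g _; ext i; rw [Fin.fin_one_eq_zero i]
    · intro a _; rfl
    · intro g _; rfl
  | succ n ih =>
    set P := (Fintype.piFinset (fun _ : Fin (n + 1) => G)).filter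
      (fun g => ∀ i : Fin n, step (g i.castSucc) (g i.succ)) with hP
    calc _ = ∑ p ∈ P.sigma (fun g => G.filter fun b => step b (g 0)),
          h p.2 * l (p.1 (Fin.last n)) := by
          refine Finset.sum_nbij' (fun g => ⟨Fin.tail g, g 0⟩) (fun p => Fin.cons p.2 p.1)
            ?_ ?_ ?_ ?_ ?_
          · intro g hg
            simp only [Finset.mem_filter, Fintype.mem_piFinset, Fin.forall_fin_succ] at hg
            simp only [hP, Finset.mem_sigma, Finset.mem_filter, Fintype.mem_piFinset, Fin.tail,
              Fin.forall_fin_succ]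
            exact ⟨⟨hg.1.2, fun i => hg.2.2 i⟩, Finset.mem_filter.2 ⟨hg.1.1, hg.2.1⟩⟩
          · rintro ⟨g, b⟩ hg
            simp only [hP, Finset.mem_sigma, Finset.mem_filter, Fintype.mem_piFinset] at hg
            simp only [Finset.mem_filter, Fintype.mem_piFinset, Fin.forall_fin_succ (n := n),
              Fin.forall_fin_succ (n := n + 1), Fin.cons_succ, Fin.cons_zero,
              Fin.castSucc_zero, ← Fin.succ_castSucc]
            exact ⟨⟨hg.2.1, Fin.forall_fin_succ.1 hg.1.1⟩, hg.2.2, hg.1.2⟩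
          · intro g _; exact Fin.cons_self_tail g
          · rintro ⟨g, b⟩ _; simp
          · intro g _; rfl
      _ ≤ ∑ g ∈ P, 2 * h (g 0) * l (g (Fin.last n)) := by
          rw [Finset.sum_sigma]
          refine Finset.sum_le_sum fun g hg => ?_
          simp only
          rw [← Finset.sum_mul]
          refine mul_le_mul_of_nonneg_right (hG _ ?_) (hl _)
          exact Fintype.mem_piFinset.1 (Finset.mem_filter.1 hg).1 0
      _ = 2 * ∑ g ∈ P, h (g 0) * l (g (Fin.last n)) := by
          rw [Finset.mul_sum]; exact Finset.sum_congr rfl fun _ _ => mul_assoc _ _ _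
      _ ≤ 2 * (2 ^ n * ∑ a ∈ G, h a * l a) := by gcongr
      _ = _ := by ring

open scoped Classical in
theorem sum_piFinset_le_factorial_mul {α : Type*} [LinearOrder α] (G : Finset α) {n : ℕ}
    (F : (Fin n → α) → ℝ≥0∞) (hF : ∀ g (σ : Equiv.Perm (Fin n)), F (g ∘ σ) = F g) :
    ∑ g ∈ Fintype.piFinset (fun _ : Fin n => G), F g
      ≤ n.factorial * ∑ g ∈ Fintype.piFinset (fun _ : Fin n => G) with Monotone g, F g := by
  have key (σ : Equiv.Perm (Fin n)) :
      ∑ g ∈ Fintype.piFinset (fun _ : Fin n => G), (if Monotone (g ∘ σ) then F (g ∘ σ) else 0)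
        = ∑ g ∈ Fintype.piFinset (fun _ : Fin n => G) with Monotone g, F g := by
    rw [Finset.sum_filter]
    refine Finset.sum_nbij' (fun g => g ∘ σ) (fun g => g ∘ σ.symm) ?_ ?_ ?_ ?_ ?_
    · intro g hg; rw [Fintype.mem_piFinset] at hg ⊢; exact fun i => hg _
    · intro g hg; rw [Fintype.mem_piFinset] at hg ⊢; exact fun i => hg _
    · intro g _; ext i; simp
    · intro g _; ext i; simp
    · intro g _; rfl
  calc _ ≤ ∑ g ∈ Fintype.piFinset (fun _ : Fin n => G), ∑ σ : Equiv.Perm (Fin n),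
        (if Monotone (g ∘ σ) then F (g ∘ σ) else 0) := by
        refine Finset.sum_le_sum fun g _ => ?_
        refine le_trans ?_ (Finset.single_le_sum (fun _ _ => zero_le)
          (Finset.mem_univ (Tuple.sort g)))
        rw [if_pos (Tuple.monotone_sort g), hF]
    _ = _ := by
        rw [Finset.sum_comm, Finset.sum_congr rfl fun σ _ => key σ, Finset.sum_const,
          Finset.card_univ, Fintype.card_perm, Fintype.card_fin, nsmul_eq_mul]

/-! ### A one-dimensional covering lemma -/

open scoped Classical in
/-- A covering lemma on the line for intervals with centers `c` and lengths `h`. -/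
theorem volume_biUnion_closedBall_le {α : Type*} (s G : Finset α) (rel : α → α → Prop)
    (c h : α → ℝ) (hh : ∀ a, 0 < h a)
    (hsum : ∀ a ∈ s, h a ≤ ∑ b ∈ G with rel b a, h b)
    (hrel : ∀ b ∈ G, ∀ a ∈ s, rel b a → |c a - c b| ≤ 3 / 2 * (h a + h b)) :
    volume (⋃ a ∈ s, Metric.closedBall (c a) (h a / 2))
      ≤ ENNReal.ofReal 42 * ENNReal.ofReal (∑ b ∈ G, h b) := by
  set B := s.filter (fun a => ∀ b ∈ G, rel b a → h b < h a) with hB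
  obtain ⟨u, huB, hdisj, hcov⟩ := Vitali.exists_disjoint_subfamily_covering_enlargement_closedBall
    (B : Set α) c (fun a => 3 * h a) (∑ a ∈ B, 3 * h a)
    (fun a ha => Finset.single_le_sum (f := fun a => 3 * h a)
      (fun b _ => by have := hh b; positivity) ha) 5 (by norm_num)
  obtain ⟨v, rfl⟩ : ∃ v : Finset α, (v : Set α) = u :=
    ⟨(B.finite_toSet.subset huB).toFinset, by simp⟩
  have hvB : v ⊆ B := by exact_mod_cast huB
  have hsub : (⋃ a ∈ s, Metric.closedBall (c a) (h a / 2)) ⊆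
      (⋃ b ∈ G, Metric.closedBall (c b) (7 / 2 * h b)) ∪
        ⋃ b ∈ v, Metric.closedBall (c b) (15 * h b) := by
    refine Set.iUnion₂_subset fun a ha => ?_
    by_cases haB : a ∈ B
    · obtain ⟨b, hb, hab⟩ := hcov a haB
      intro x hx
      refine Or.inr (Set.mem_iUnion₂.2 ⟨b, hb, ?_⟩)
      have := hab (Metric.closedBall_subset_closedBall (by have := hh a; linarith) hx)
      convert this using 2
      ring
    · obtain ⟨b, hbG, hba, hlt⟩ : ∃ b ∈ G, rel b a ∧ h a ≤ h b := by
        by_contra! hcon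
        exact haB (Finset.mem_filter.2 ⟨ha, hcon⟩)
      intro x hx
      refine Or.inl (Set.mem_iUnion₂.2 ⟨b, hbG, ?_⟩)
      have h1 := hrel b hbG a ha hba
      rw [Metric.mem_closedBall, Real.dist_eq] at hx ⊢
      have := abs_sub_le x (c a) (c b)
      linarith
  have hvol : ∀ (t : Finset α) (K : ℝ), 0 ≤ K →
      volume (⋃ b ∈ t, Metric.closedBall (c b) (K * h b))
        ≤ ENNReal.ofReal (2 * K * ∑ b ∈ t, h b) := by
    intro t K hK
    refine (measure_biUnion_finset_le _ _).trans ?_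
    rw [Finset.mul_sum, ENNReal.ofReal_sum_of_nonneg
      (fun b _ => by have := hh b; positivity)]
    refine Finset.sum_le_sum fun b _ => ?_
    rw [Real.volume_closedBall, mul_assoc]
  have hv : ∑ b ∈ v, h b ≤ ∑ b ∈ G, h b := by
    calc ∑ b ∈ v, h b ≤ ∑ a ∈ v, ∑ b ∈ G with rel b a, h b :=
          Finset.sum_le_sum fun a ha => hsum a (Finset.mem_filter.1 (hvB ha)).1
      _ = ∑ b ∈ v.biUnion (fun a => G.filter fun b => rel b a), h b := by
          refine (Finset.sum_biUnion fun a ha a' ha' hne => ?_).symm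
          refine Finset.disjoint_left.2 fun b hb hb' => ?_
          have hmem : ∀ a ∈ v, b ∈ G.filter (fun b => rel b a) →
              c b ∈ Metric.closedBall (c a) (3 * h a) := by
            intro a ha hb
            obtain ⟨hbG, hba⟩ := Finset.mem_filter.1 hb
            obtain ⟨has, haB⟩ := Finset.mem_filter.1 (hvB ha)
            rw [Metric.mem_closedBall, dist_comm, Real.dist_eq]
            have := hrel b hbG a has hba
            have := haB b hbG hba
            linarith
          exact Set.disjoint_left.1 (hdisj ha ha' hne) (hmem a ha hb) (hmem a' ha' hb')
      _ ≤ ∑ b ∈ G, h b := by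
          refine Finset.sum_le_sum_of_subset_of_nonneg ?_ fun b _ _ => (hh b).le
          exact Finset.biUnion_subset.2 fun a _ => Finset.filter_subset _ _
  have hG0 : 0 ≤ ∑ b ∈ G, h b := Finset.sum_nonneg fun b _ => (hh b).le
  have hv0 : 0 ≤ ∑ b ∈ v, h b := Finset.sum_nonneg fun b _ => (hh b).le
  refine (measure_mono hsub).trans ((measure_union_le _ _).trans ?_)
  refine (add_le_add (hvol G (7 / 2) (by norm_num)) (hvol v 15 (by norm_num))).trans ?_
  rw [← ENNReal.ofReal_add (by positivity) (by positivity), ← ENNReal.ofReal_mul (by norm_num)]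
  exact ENNReal.ofReal_le_ofReal (by linarith)

/-! ### Geometry of parallelograms -/

theorem measurableSet_strip {f : ℝ → ℝ} (hf : Continuous f) (a l h : ℝ) :
    MeasurableSet {z : ℝ × ℝ | |z.1 - a| ≤ l / 2 ∧ |z.2 - f z.1| ≤ h / 2} := by
  refine IsClosed.measurableSet (IsClosed.and ?_ ?_)
  · exact isClosed_le (by fun_prop) continuous_const
  · exact isClosed_le (by fun_prop) continuous_const

theorem volume_strip {f : ℝ → ℝ} (hf : Continuous f) (a l h : ℝ) :
    volume {z : ℝ × ℝ | |z.1 - a| ≤ l / 2 ∧ |z.2 - f z.1| ≤ h / 2}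
      = ENNReal.ofReal l * ENNReal.ofReal h := by
  have hslice (x : ℝ) : volume (Prod.mk x ⁻¹'
      {z : ℝ × ℝ | |z.1 - a| ≤ l / 2 ∧ |z.2 - f z.1| ≤ h / 2}) =
        (Metric.closedBall a (l / 2)).indicator (fun _ => ENNReal.ofReal h) x := by
    by_cases hx : |x - a| ≤ l / 2
    · rw [Set.indicator_of_mem (by rwa [Metric.mem_closedBall, Real.dist_eq])]
      have : Prod.mk x ⁻¹' {z : ℝ × ℝ | |z.1 - a| ≤ l / 2 ∧ |z.2 - f z.1| ≤ h / 2}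
          = Metric.closedBall (f x) (h / 2) := by
        ext y; simp [hx, Real.dist_eq]
      rw [this, Real.volume_closedBall, mul_div_cancel₀ _ two_ne_zero]
    · rw [Set.indicator_of_notMem (by rwa [Metric.mem_closedBall, Real.dist_eq])]
      have : Prod.mk x ⁻¹' {z : ℝ × ℝ | |z.1 - a| ≤ l / 2 ∧ |z.2 - f z.1| ≤ h / 2} = ∅ := by
        ext y; simp [hx]
      rw [this, measure_empty]
  rw [Measure.volume_eq_prod, Measure.prod_apply (measurableSet_strip hf a l h),
    lintegral_congr hslice, lintegral_indicator_const Metric.isClosed_closedBall.measurableSet,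
    Real.volume_closedBall, mul_div_cancel₀ _ two_ne_zero, mul_comm]

namespace Pgram

/-- The height of the central line of `R` above `x`. -/
def center (R : Pgram) (x : ℝ) : ℝ := R.yc + R.slope * (x - R.xc)

theorem continuous_center (R : Pgram) : Continuous R.center := by
  unfold center; fun_prop

/-- The shadow of `R`. -/
def shadow (R : Pgram) : Set ℝ := Metric.closedBall R.xc (R.len / 2)

theorem mem_shadow {R : Pgram} {x : ℝ} : x ∈ R.shadow ↔ |x - R.xc| ≤ R.len / 2 := by
  rw [shadow, Metric.mem_closedBall, Real.dist_eq]

theorem mem_toSet {R : Pgram} {z : ℝ × ℝ} :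
    z ∈ R.toSet ↔ z.1 ∈ R.shadow ∧ |z.2 - R.center z.1| ≤ R.height / 2 := by
  rw [mem_shadow]; rfl

theorem measurableSet_toSet (R : Pgram) : MeasurableSet R.toSet :=
  measurableSet_strip R.continuous_center _ _ _

theorem area_nonneg (R : Pgram) : 0 ≤ R.area := (mul_pos R.len_pos R.height_pos).le

/-- `R` is related to `S` if its shadow contains the one of `S`, the uncertainty intervals
intersect and the parallelograms intersect. -/
def Rel (R S : Pgram) : Prop :=
  S.shadow ⊆ R.shadow ∧ (R.U ∩ S.U).Nonempty ∧ (R.toSet ∩ S.toSet).Nonempty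

theorem rel_refl (R : Pgram) : R.Rel R := by
  have hl := R.len_pos
  have hh := R.height_pos
  refine ⟨subset_rfl, ⟨R.slope, ?_⟩, ⟨(R.xc, R.yc), ?_⟩⟩
  · have : 0 < R.height / R.len := by positivity
    rw [Set.inter_self]
    exact ⟨by linarith, by linarith⟩
  · rw [Set.inter_self, mem_toSet, mem_shadow, center]
    constructor <;> simp <;> linarith

theorem len_le_of_shadow_subset {R S : Pgram} (h : S.shadow ⊆ R.shadow) : S.len ≤ R.len := by
  have hl := S.len_pos
  have h1 := mem_shadow.1 (h (a := S.xc + S.len / 2) (mem_shadow.2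
    (by rw [add_sub_cancel_left, abs_of_pos (by positivity)])))
  have h2 := mem_shadow.1 (h (a := S.xc - S.len / 2) (mem_shadow.2
    (by rw [sub_sub_cancel_left, abs_neg, abs_of_pos (by positivity)])))
  rw [abs_le] at h1 h2
  linarith [h1.2, h2.1]

theorem Rel.abs_center_sub_le {R S : Pgram} (h : R.Rel S) {x : ℝ} (hx : x ∈ S.shadow) :
    |S.center x - R.center x| ≤ 3 / 2 * (S.height + R.height) := by
  obtain ⟨hsh, ⟨t, htR, htS⟩, ⟨z, hzR, hzS⟩⟩ := h
  have hlen := len_le_of_shadow_subset hsh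
  have hlR := R.len_pos
  have hlS := S.len_pos
  have hhR := R.height_pos
  have hhS := S.height_pos
  rw [mem_toSet] at hzR hzS
  have hslope : |S.slope - R.slope| ≤ S.height / S.len + R.height / R.len := by
    rw [abs_le]
    constructor <;> linarith [htR.1, htR.2, htS.1, htS.2]
  have hdist : |x - z.1| ≤ S.len := by
    have h1 := mem_shadow.1 hx
    have h2 := mem_shadow.1 hzS.1
    rw [abs_le] at *
    constructor <;> linarith
  have hprod : |(S.slope - R.slope) * (x - z.1)| ≤ S.height + R.height := by
    rw [abs_mul]
    calc _ ≤ (S.height / S.len + R.height / R.len) * S.len := by gcongr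
      _ = S.height + R.height * (S.len / R.len) := by field_simp
      _ ≤ S.height + R.height * 1 := by
        gcongr
        exact (div_le_one hlR).2 hlen
      _ = _ := by ring
  have hid : S.center x - R.center x = (z.2 - R.center z.1) - (z.2 - S.center z.1)
      + (S.slope - R.slope) * (x - z.1) := by
    unfold center; ring
  rw [hid]
  have h1 := hzR.2
  have h2 := hzS.2
  rw [abs_le] at *
  constructor <;> linarith

theorem shadow_subset_of_volume_ne_zero {R S : Pgram} (hR : R.dyadicShadow)
    (hS : S.dyadicShadow) (hlen : S.len ≤ R.len) (hvol : volume (R.toSet ∩ S.toSet) ≠ 0) :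
    S.shadow ⊆ R.shadow := by
  obtain ⟨k', m', hl', hc'⟩ := hR
  obtain ⟨k, m, hl, hc⟩ := hS
  have hk : k ≤ k' := by
    rw [hl, hl'] at hlen
    exact (zpow_le_zpow_iff_right₀ (by norm_num)).1 hlen
  obtain ⟨d, rfl⟩ := Int.le.dest hk
  rw [zpow_add₀ two_ne_zero, zpow_natCast] at hl' hc'
  have hw : (0 : ℝ) < 2 ^ k := by positivity
  set w : ℝ := 2 ^ k
  have hN : ((2 ^ d : ℤ) : ℝ) = 2 ^ d := by push_cast; rfl
  set N : ℤ := 2 ^ d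
  have hshS (x : ℝ) : x ∈ S.shadow ↔ m * w ≤ x ∧ x ≤ (m + 1) * w := by
    rw [mem_shadow, abs_le, hl, hc]
    constructor <;> rintro ⟨h1, h2⟩ <;> constructor <;> linarith
  have hshR (x : ℝ) : x ∈ R.shadow ↔ (N * m' : ℤ) * w ≤ x ∧ x ≤ (N * m' + N : ℤ) * w := by
    rw [mem_shadow, abs_le, hl', hc']
    push_cast
    rw [hN]
    constructor <;> rintro ⟨h1, h2⟩ <;> constructor <;> linarith
  have hnull (x₀ : ℝ) (hx₀ : ∀ x ∈ S.shadow, x ∈ R.shadow → x = x₀) : False := by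
    refine hvol (measure_mono_null (t := {z | |z.1 - x₀| ≤ 0 / 2 ∧
      |z.2 - R.center z.1| ≤ R.height / 2}) ?_ ?_)
    · rintro z ⟨hzR, hzS⟩
      rw [mem_toSet] at hzR hzS
      exact ⟨by rw [hx₀ _ hzS.1 hzR.1]; simp, hzR.2⟩
    · rw [volume_strip R.continuous_center]; simp
  have hle (a b : ℤ) (hab : a ≤ b) : (a : ℝ) * w ≤ b * w := by
    have : (a : ℝ) ≤ b := by exact_mod_cast hab
    gcongr
  rcases lt_or_ge m (N * m') with h1 | h1
  · refine (hnull ((m + 1) * w) fun x hx hx' => ?_).elim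
    have := hle _ _ (Int.add_one_le_iff.2 h1)
    rw [hshS] at hx
    rw [hshR] at hx'
    push_cast at this hx'
    linarith
  rcases lt_or_ge m (N * m' + N) with h2 | h2
  · intro x hx
    rw [hshS] at hx
    rw [hshR]
    have h3 := hle _ _ h1
    have h4 := hle _ _ (Int.add_one_le_iff.2 h2)
    push_cast at h3 h4 ⊢
    constructor <;> linarith
  · refine (hnull (m * w) fun x hx hx' => ?_).elim
    have := hle _ _ h2
    rw [hshS] at hx
    rw [hshR] at hx'
    push_cast at this hx'
    linarith

theorem exists_linearOrder_len_antitone :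
    ∃ _ : LinearOrder Pgram, ∀ R S : Pgram, R ≤ S → S.len ≤ R.len := by
  classical
  let _ : LinearOrder Pgram := linearOrderOfSTO WellOrderingRel
  let f : Pgram → ℝ ×ₗ Pgram := fun R => toLex (-R.len, R)
  have hf : Function.Injective f := fun R S h => congrArg (fun p => (ofLex p).2) h
  refine ⟨LinearOrder.lift' f hf, fun R S h => ?_⟩
  have h' : f R ≤ f S := h
  rcases Prod.Lex.le_iff.1 h' with h' | h'
  · exact (neg_lt_neg_iff.1 h').le
  · exact (neg_injective h'.1).ge

open scoped Classical in
theorem volume_biUnion_toSet_le (𝓡 G : Finset Pgram)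
    (hsum : ∀ R ∈ 𝓡, R.height ≤ ∑ S ∈ G with S.Rel R, S.height) :
    volume (⋃ R ∈ 𝓡, R.toSet)
      ≤ ENNReal.ofReal 42 * ENNReal.ofReal (∑ R ∈ G, R.area) := by
  have hslice (x : ℝ) : volume (Prod.mk x ⁻¹' ⋃ R ∈ 𝓡, R.toSet) ≤
      ENNReal.ofReal 42 *
        ∑ R ∈ G, R.shadow.indicator (fun _ => ENNReal.ofReal R.height) x := by
    have h1 : Prod.mk x ⁻¹' (⋃ R ∈ 𝓡, R.toSet) =
        ⋃ R ∈ 𝓡.filter (fun R => x ∈ R.shadow),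
          Metric.closedBall (R.center x) (R.height / 2) := by
      ext y
      simp [mem_toSet, Real.dist_eq, and_assoc, and_left_comm]
    have h2 : ∑ R ∈ G, R.shadow.indicator (fun _ => ENNReal.ofReal R.height) x =
        ENNReal.ofReal (∑ R ∈ G.filter (fun R => x ∈ R.shadow), R.height) := by
      rw [ENNReal.ofReal_sum_of_nonneg fun R _ => R.height_pos.le, Finset.sum_filter]
      rfl
    rw [h1, h2]
    refine volume_biUnion_closedBall_le _ _ Rel (fun R => R.center x) Pgram.height
      Pgram.height_pos ?_ ?_
    · intro R hR
      obtain ⟨hR, hx⟩ := Finset.mem_filter.1 hR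
      refine (hsum R hR).trans (le_of_eq (Finset.sum_congr ?_ fun _ _ => rfl))
      ext S
      simp only [Finset.mem_filter]
      exact ⟨fun h => ⟨⟨h.1, h.2.1 hx⟩, h.2⟩, fun h => ⟨h.1.1, h.2⟩⟩
    · intro S _ R hR hSR
      exact hSR.abs_center_sub_le (Finset.mem_filter.1 hR).2
  rw [Measure.volume_eq_prod, Measure.prod_apply
    (Finset.measurableSet_biUnion _ fun R _ => R.measurableSet_toSet)]
  refine (lintegral_mono hslice).trans (le_of_eq ?_)
  have hmeas (R : Pgram) : MeasurableSet R.shadow := Metric.isClosed_closedBall.measurableSet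
  rw [lintegral_const_mul _ (Finset.measurable_sum _ fun R _ =>
      measurable_const.indicator (hmeas R)),
    lintegral_finsetSum _ (fun R _ => measurable_const.indicator (hmeas R)),
    ENNReal.ofReal_sum_of_nonneg fun R _ => R.area_nonneg]
  congr 1
  refine Finset.sum_congr rfl fun R _ => ?_
  rw [lintegral_indicator_const (hmeas R), shadow, Real.volume_closedBall,
    mul_div_cancel₀ _ two_ne_zero, area, ENNReal.ofReal_mul R.len_pos.le, mul_comm]

/-- The volume of the intersection of a tuple of parallelograms with a common direction in their
uncertainty intervals. -/
def tupleVolume {n : ℕ} (g : Fin n → Pgram) : ℝ≥0∞ :=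
  Set.indicator {g' : Fin n → Pgram | (⋂ i, (g' i).U).Nonempty}
    (fun g' => volume (⋂ i, (g' i).toSet)) g

theorem tupleVolume_comp_perm {n : ℕ} (g : Fin n → Pgram) (σ : Equiv.Perm (Fin n)) :
    tupleVolume (g ∘ σ) = tupleVolume g := by
  have h1 : ⋂ i, ((g ∘ σ) i).U = ⋂ i, (g i).U := σ.surjective.iInter_comp fun i => (g i).U
  have h2 : ⋂ i, ((g ∘ σ) i).toSet = ⋂ i, (g i).toSet :=
    σ.surjective.iInter_comp fun i => (g i).toSet
  have h3 : g ∘ σ ∈ {g' : Fin n → Pgram | (⋂ i, (g' i).U).Nonempty} ↔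
      g ∈ {g' : Fin n → Pgram | (⋂ i, (g' i).U).Nonempty} := by
    rw [Set.mem_ofPred_eq, Set.mem_ofPred_eq, h1]
  unfold tupleVolume
  by_cases h : g ∈ {g' : Fin n → Pgram | (⋂ i, (g' i).U).Nonempty}
  · rw [Set.indicator_of_mem (h3.2 h), Set.indicator_of_mem h, h2]
  · rw [Set.indicator_of_notMem (h3.not.2 h), Set.indicator_of_notMem h]

open scoped Classical in
theorem sum_tupleVolume_le [LinearOrder Pgram] (hord : ∀ R S : Pgram, R ≤ S → S.len ≤ R.len)
    (G : Finset Pgram) (hdy : ∀ R ∈ G, R.dyadicShadow)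
    (hG : ∀ R ∈ G, ∑ S ∈ G with S < R ∧ S.Rel R, S.height ≤ R.height) (n : ℕ) :
    ∑ g ∈ Fintype.piFinset (fun _ : Fin (n + 1) => G), tupleVolume g
      ≤ ENNReal.ofReal ((n + 1).factorial * 2 ^ n) *
        ENNReal.ofReal (∑ R ∈ G, R.area) := by
  obtain ⟨step, hstep_iff⟩ : ∃ step : Pgram → Pgram → Prop,
      ∀ S R, step S R ↔ S = R ∨ (S < R ∧ S.Rel R) := ⟨_, fun _ _ => Iff.rfl⟩
  have hstep (R : Pgram) (hR : R ∈ G) : ∑ S ∈ G with step S R, S.height ≤ 2 * R.height := by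
    have hsub : G.filter (fun S => step S R) ⊆
        insert R (G.filter fun S => S < R ∧ S.Rel R) := by
      intro S hS
      obtain ⟨hS, h⟩ := Finset.mem_filter.1 hS
      rcases (hstep_iff _ _).1 h with rfl | h
      · exact Finset.mem_insert_self _ _
      · exact Finset.mem_insert_of_mem (Finset.mem_filter.2 ⟨hS, h⟩)
    refine (Finset.sum_le_sum_of_subset_of_nonneg hsub fun S _ _ => S.height_pos.le).trans ?_
    rw [Finset.sum_insert (by simp)]
    linarith [hG R hR]
  have hbound (g : Fin (n + 1) → Pgram) :
      tupleVolume g ≤ ENNReal.ofReal ((g 0).height * (g (Fin.last n)).len) := by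
    refine (Set.indicator_le_self _ _ _).trans ?_
    rw [mul_comm, ENNReal.ofReal_mul (Pgram.len_pos _).le,
      ← volume_strip (g 0).continuous_center (g (Fin.last n)).xc]
    refine measure_mono fun z hz => ?_
    rw [Set.mem_iInter] at hz
    exact ⟨(hz (Fin.last n)).1, (hz 0).2⟩
  have hchain (g : Fin (n + 1) → Pgram) (hgG : ∀ i, g i ∈ G) (hmono : Monotone g)
      (hg : tupleVolume g ≠ 0) (i : Fin n) : step (g i.castSucc) (g i.succ) := by
    have hle := hmono i.castSucc_le_succ
    rcases hle.eq_or_lt with h | h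
    · exact (hstep_iff _ _).2 (Or.inl h)
    · obtain ⟨⟨t, ht⟩, hv⟩ := Set.indicator_apply_ne_zero.1 hg
      rw [Set.mem_iInter] at ht
      have hv' : volume ((g i.castSucc).toSet ∩ (g i.succ).toSet) ≠ 0 := fun h0 =>
        hv (measure_mono_null (Set.subset_inter (Set.iInter_subset _ i.castSucc)
          (Set.iInter_subset _ i.succ)) h0)
      exact (hstep_iff _ _).2 (Or.inr ⟨h, shadow_subset_of_volume_ne_zero (hdy _ (hgG _))
        (hdy _ (hgG _)) (hord _ _ hle) hv', ⟨t, ht _, ht _⟩, nonempty_of_measure_ne_zero hv'⟩)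
  calc _ ≤ ((n + 1).factorial : ℝ≥0∞) *
        ∑ g ∈ Fintype.piFinset (fun _ : Fin (n + 1) => G) with Monotone g, tupleVolume g :=
        sum_piFinset_le_factorial_mul G _ tupleVolume_comp_perm
    _ ≤ ((n + 1).factorial : ℝ≥0∞) * ∑ g ∈ Fintype.piFinset (fun _ : Fin (n + 1) => G) with
          ∀ i : Fin n, step (g i.castSucc) (g i.succ),
          ENNReal.ofReal ((g 0).height * (g (Fin.last n)).len) := by
        gcongr
        rw [Finset.sum_filter, Finset.sum_filter]
        refine Finset.sum_le_sum fun g hg => ?_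
        split_ifs with h1 h2
        · exact hbound g
        · rw [nonpos_iff_eq_zero]
          by_contra h3
          exact h2 (hchain g (Fintype.mem_piFinset.1 hg) h1 h3)
        · exact zero_le
        · exact zero_le
    _ ≤ ((n + 1).factorial : ℝ≥0∞) * ENNReal.ofReal (2 ^ n * ∑ R ∈ G, R.area) := by
        rw [← ENNReal.ofReal_sum_of_nonneg fun g _ =>
          mul_nonneg (Pgram.height_pos _).le (Pgram.len_pos _).le]
        gcongr
        refine (sum_chains_le G step height len (fun R => R.len_pos.le) hstep n).trans
          (le_of_eq ?_)
        simp only [area, mul_comm]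
    _ = _ := by
        rw [ENNReal.ofReal_mul (by positivity), ENNReal.ofReal_mul (by positivity),
          ENNReal.ofReal_natCast, mul_assoc]

theorem sum_indicator_E_pow_le (G : Finset Pgram) (u : ℝ × ℝ → ℝ) (n : ℕ) (z : ℝ × ℝ) :
    (∑ R ∈ G, (Pgram.E u R).indicator (fun _ => (1 : ℝ≥0∞)) z) ^ n
      ≤ ∑ g ∈ Fintype.piFinset (fun _ : Fin n => G),
        Set.indicator {g' : Fin n → Pgram | (⋂ i, (g' i).U).Nonempty}
          (fun g' => (⋂ i, (g' i).toSet).indicator (fun _ => (1 : ℝ≥0∞)) z) g := by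
  rw [Finset.sum_pow']
  refine Finset.sum_le_sum fun g _ => ?_
  by_cases h : ∀ i, z ∈ Pgram.E u (g i)
  · have hU : g ∈ {g' : Fin n → Pgram | (⋂ i, (g' i).U).Nonempty} :=
      ⟨u z, Set.mem_iInter.2 fun i => (h i).2⟩
    rw [Set.indicator_of_mem hU, Set.indicator_of_mem (Set.mem_iInter.2 fun i => (h i).1)]
    exact Finset.prod_le_one' fun i _ => (Set.indicator_le_self _ _ _)
  · push Not at h
    obtain ⟨i, hi⟩ := h
    rw [Finset.prod_eq_zero (Finset.mem_univ i) (Set.indicator_of_notMem hi _)]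
    exact zero_le

theorem lintegral_sum_indicator_E_pow_le (G : Finset Pgram) (u : ℝ × ℝ → ℝ) (n : ℕ) :
    ∫⁻ z, (∑ R ∈ G, (Pgram.E u R).indicator (fun _ => (1 : ℝ≥0∞)) z) ^ n
      ≤ ∑ g ∈ Fintype.piFinset (fun _ : Fin n => G), tupleVolume g := by
  have hmeas (g : Fin n → Pgram) : MeasurableSet (⋂ i, (g i).toSet) :=
    MeasurableSet.iInter fun i => (g i).measurableSet_toSet
  refine (lintegral_mono (sum_indicator_E_pow_le G u n)).trans (le_of_eq ?_)
  rw [lintegral_finsetSum]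
  · refine Finset.sum_congr rfl fun g _ => ?_
    by_cases hg : g ∈ {g' : Fin n → Pgram | (⋂ i, (g' i).U).Nonempty}
    · simp only [tupleVolume, Set.indicator_of_mem hg]
      rw [lintegral_indicator_const (hmeas g), one_mul]
    · simp only [tupleVolume, Set.indicator_of_notMem hg, lintegral_zero]
  · intro g _
    by_cases hg : g ∈ {g' : Fin n → Pgram | (⋂ i, (g' i).U).Nonempty}
    · simp only [Set.indicator_of_mem hg]
      exact measurable_const.indicator (hmeas g)
    · simp only [Set.indicator_of_notMem hg, measurable_const]

/-- The counting function takes values in the natural numbers, so its powers increase with the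
exponent. -/
theorem sum_indicator_rpow_le_pow_ceil {α : Type*} (G : Finset Pgram) (A : Pgram → Set α) (z : α)
    {q : ℝ} (hq : 0 < q) :
    (∑ R ∈ G, (A R).indicator (fun _ => (1 : ℝ≥0∞)) z) ^ q
      ≤ (∑ R ∈ G, (A R).indicator (fun _ => (1 : ℝ≥0∞)) z) ^ ⌈q⌉₊ := by
  classical
  have hN : ∑ R ∈ G, (A R).indicator (fun _ => (1 : ℝ≥0∞)) z
      = ((G.filter fun R => z ∈ A R).card : ℕ) := by
    rw [Finset.card_filter]; push_cast; rfl
  rw [hN]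
  rcases Nat.eq_zero_or_pos (G.filter fun R => z ∈ A R).card with h | h
  · rw [h, Nat.cast_zero, ENNReal.zero_rpow_of_pos hq]
    exact zero_le
  · rw [← ENNReal.rpow_natCast]
    exact ENNReal.rpow_le_rpow_of_exponent_le (by exact_mod_cast h) (Nat.le_ceil q)

end Pgram

/-- **Covering lemma for parallelograms with vertical edges and dyadic shadows.** -/
theorem parallelogram_covering_lemma :
    ∃ (C : ℝ) (Cn : ℕ → ℝ) (Cq : ℝ → ℝ), 0 < C ∧
      ∀ 𝓡 : Finset Pgram, (∀ R ∈ 𝓡, R.dyadicShadow) →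
        ∃ 𝓖 ⊆ 𝓡,
          volume (⋃ R ∈ 𝓡, R.toSet)
              ≤ ENNReal.ofReal C * ENNReal.ofReal (∑ R ∈ 𝓖, R.area) ∧
          (∀ n : ℕ, 1 ≤ n →
            (∑ g ∈ Fintype.piFinset (fun _ : Fin n => 𝓖),
                Set.indicator {g' : Fin n → Pgram | (⋂ i, (g' i).U).Nonempty}
                  (fun g' => volume (⋂ i, (g' i).toSet)) g)
              ≤ ENNReal.ofReal (Cn n) * ENNReal.ofReal (∑ R ∈ 𝓖, R.area)) ∧
          (∀ u : ℝ × ℝ → ℝ, Measurable u → ∀ q : ℝ, 0 < q →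
            (∫⁻ z : ℝ × ℝ,
                (∑ R ∈ 𝓖, (Pgram.E u R).indicator (fun _ => (1 : ℝ≥0∞)) z) ^ q ∂volume)
              ≤ ENNReal.ofReal (Cq q) * ENNReal.ofReal (∑ R ∈ 𝓖, R.area)) := by
  refine ⟨42, fun n => n.factorial * 2 ^ (n - 1),
    fun q => ⌈q⌉₊.factorial * 2 ^ (⌈q⌉₊ - 1), by norm_num, fun 𝓡 hdy => ?_⟩
  classical
  obtain ⟨_, hord⟩ := Pgram.exists_linearOrder_len_antitone
  obtain ⟨G, hG𝓡, hG, h𝓡⟩ := exists_greedy_subset Pgram.Rel Pgram.rel_refl Pgram.height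
    (fun R => R.height_pos.le) 𝓡
  have htuple (n : ℕ) (hn : 1 ≤ n) :
      ∑ g ∈ Fintype.piFinset (fun _ : Fin n => G), Pgram.tupleVolume g
        ≤ ENNReal.ofReal (n.factorial * 2 ^ (n - 1)) * ENNReal.ofReal (∑ R ∈ G, R.area) := by
    obtain ⟨m, rfl⟩ := Nat.exists_eq_add_of_le' hn
    exact Pgram.sum_tupleVolume_le hord G (fun R hR => hdy R (hG𝓡 hR))
      (fun R hR => by convert hG R hR) m
  refine ⟨G, hG𝓡, ?_, htuple, fun u _ q hq => ?_⟩
  · refine Pgram.volume_biUnion_toSet_le 𝓡 G fun R hR => (h𝓡 R hR).trans ?_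
    refine Finset.sum_le_sum_of_subset_of_nonneg (fun S hS => ?_) fun S _ _ => S.height_pos.le
    have hS' := Finset.mem_filter.1 hS
    exact Finset.mem_filter.2 ⟨hS'.1, hS'.2.2⟩
  · exact (lintegral_mono fun z => Pgram.sum_indicator_rpow_le_pow_ceil G _ z hq).trans
      ((Pgram.lintegral_sum_indicator_E_pow_le G u _).trans (htuple _ (Nat.ceil_pos.2 hq)))
end
end
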